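/- arXiv:1411.6283 — 3 statements merged into one kernel-verified Lean document; each statement's English description precedes it below -/
import Mathlib

section
/- Let n ≥ 5 and 3 ≤ K ≤ n−2, and let s, t₁, t₂ ∈ V with t₁ < t₂ < s and s ≥ 4. The strengthened triangle inequality x_{s,t₁} + x_{s,t₂} − x_{t₁,t₂} + x_s ≤ 1 is facet-defining for P_{n,K} if and only if t₂ ≥ 4 or K ≤ n−3. -/
/-- A `K`-partition of `V = {1,…,n}`: a family of `K` nonempty pairwise disjoint
subsets of `V` (clusters) whose union is `V`. -/
structure KPartition (n K : ℕ) where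
  parts : Finset (Finset ℕ)
  card_parts : parts.card = K
  parts_nonempty : ∀ C ∈ parts, C.Nonempty
  parts_disjoint : ∀ C ∈ parts, ∀ D ∈ parts, C ≠ D → Disjoint C D
  parts_cover : parts.sup id = Finset.Icc 1 n

/-- The ambient space: one (symmetric) edge coordinate for each pair of vertices and one
representative coordinate for each vertex (only the coordinates of edges `uv ∈ E` and of
vertices `v ∈ {4,…,n}` are actually used; the remaining ones are affinely determined, so
affine dimensions agree with those in `ℝ^{|E|+n-3}`). -/
abbrev GPoint : Type := (ℕ × ℕ → ℝ) × (ℕ → ℝ)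

open Classical in
/-- The characteristic vector of a `K`-partition: edge component `x_{u,v} = 1` iff `u` and `v`
lie in the same cluster; representative component `x_v = 1` (for `v ∈ {4,…,n}`) iff `v` is the
smallest element of its cluster. -/
noncomputable def charVec (n K : ℕ) (π : KPartition n K) : GPoint :=
  ⟨fun p => if ∃ C ∈ π.parts, p.1 ∈ C ∧ p.2 ∈ C then 1 else 0,
   fun v => if 4 ≤ v ∧ ∃ C ∈ π.parts, v ∈ C ∧ ∀ w ∈ C, v ≤ w then 1 else 0⟩

/-- `P_{n,K}`: the convex hull of the characteristic vectors of all `K`-partitions. -/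
noncomputable def PolyP (n K : ℕ) : Set GPoint :=
  convexHull ℝ {x | ∃ π : KPartition n K, x = charVec n K π}

/-- Affine dimension of a set: the rank of the direction of its affine span. -/
noncomputable def adim (s : Set GPoint) : ℕ :=
  Module.finrank ℝ (affineSpan ℝ s).direction

/-- `f x ≤ b` is a valid inequality for `P_{n,K}` which is facet-defining. -/
def IsFacetLe (n K : ℕ) (f : GPoint → ℝ) (b : ℝ) : Prop :=
  (∀ x ∈ PolyP n K, f x ≤ b) ∧
  adim {x | x ∈ PolyP n K ∧ f x = b} + 1 = adim (PolyP n K)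

/-- `f x ≥ b` is a valid inequality for `P_{n,K}` which is facet-defining. -/
def IsFacetGe (n K : ℕ) (f : GPoint → ℝ) (b : ℝ) : Prop :=
  (∀ x ∈ PolyP n K, b ≤ f x) ∧
  adim {x | x ∈ PolyP n K ∧ f x = b} + 1 = adim (PolyP n K)

/-- Sum of the edge components of `x` over the edges with both endpoints in `A`. -/
noncomputable def edgeSum (A : Finset ℕ) (x : GPoint) : ℝ :=
  ∑ e ∈ A.offDiag.filter (fun e => e.1 < e.2), x.1 e

namespace StrengthenedTriangle

section Dimension

variable {T : Set GPoint} {f : GPoint →ₗ[ℝ] ℝ} {b : ℝ}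

theorem finrank_sup_span_singleton_of_notMem (W : Submodule ℝ GPoint) [FiniteDimensional ℝ W]
    {v : GPoint} (hv : v ∉ W) :
    Module.finrank ℝ (W ⊔ Submodule.span ℝ {v} : Submodule ℝ GPoint) =
      Module.finrank ℝ W + 1 := by
  have hv0 : v ≠ 0 := fun h => hv (h ▸ W.zero_mem)
  have h := Submodule.finrank_sup_add_finrank_inf_eq W (Submodule.span ℝ {v})
  have hbot : W ⊓ Submodule.span ℝ {v} = ⊥ := by
    rw [← disjoint_iff, Submodule.disjoint_span_singleton' hv0]
    exact hv
  rw [hbot, finrank_bot, finrank_span_singleton hv0] at h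
  exact h

theorem vectorSpan_convexHull (T : Set GPoint) :
    vectorSpan ℝ (convexHull ℝ T) = vectorSpan ℝ T := by
  rw [← direction_affineSpan, affineSpan_convexHull, direction_affineSpan]

theorem finiteDimensional_vectorSpan_of_subset_convexHull (hT : T.Finite) {F : Set GPoint}
    (hF : F ⊆ convexHull ℝ T) : FiniteDimensional ℝ (vectorSpan ℝ F) := by
  have := finiteDimensional_vectorSpan_of_finite ℝ hT
  exact Submodule.finiteDimensional_of_le
    ((vectorSpan_mono ℝ hF).trans (vectorSpan_convexHull T).le)

theorem vectorSpan_le_ker {F : Set GPoint} {g : GPoint →ₗ[ℝ] ℝ} {c : ℝ}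
    (h : ∀ x ∈ F, g x = c) : vectorSpan ℝ F ≤ LinearMap.ker g := by
  rw [vectorSpan_def, Submodule.span_le]
  rintro _ ⟨x, hx, y, hy, rfl⟩
  simp [h x hx, h y hy]

/-- A face of a polytope has codimension one as soon as every linear functional constant on its
vertices is, up to a constant, a multiple of the functional defining it. -/
theorem adim_face_add_one (hT : T.Finite) {x₀ y₀ : GPoint}
    (hx₀ : x₀ ∈ T) (hfx₀ : f x₀ = b) (hy₀ : y₀ ∈ T) (hfy₀ : f y₀ ≠ b)
    (H : ∀ (g : GPoint →ₗ[ℝ] ℝ) (c : ℝ), (∀ x ∈ T, f x = b → g x = c) →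
      ∃ l : ℝ, ∀ x ∈ T, g x - c = l * (f x - b)) :
    adim {x | x ∈ convexHull ℝ T ∧ f x = b} + 1 = adim (convexHull ℝ T) := by
  unfold adim
  rw [direction_affineSpan, direction_affineSpan]
  set F : Set GPoint := {x | x ∈ convexHull ℝ T ∧ f x = b} with hF
  have hFT : F ⊆ convexHull ℝ T := fun x hx => hx.1
  have := finiteDimensional_vectorSpan_of_subset_convexHull hT hFT
  have hx₀F : x₀ ∈ F := ⟨subset_convexHull ℝ T hx₀, hfx₀⟩
  have hv : y₀ - x₀ ∉ vectorSpan ℝ F := by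
    intro h
    have := vectorSpan_le_ker (g := f) (c := b) (fun x (hx : x ∈ F) => hx.2) h
    rw [LinearMap.mem_ker, map_sub, hfx₀, sub_eq_zero] at this
    exact hfy₀ this
  rw [← finrank_sup_span_singleton_of_notMem _ hv]
  suffices hspan : vectorSpan ℝ F ⊔ Submodule.span ℝ {y₀ - x₀} =
      vectorSpan ℝ (convexHull ℝ T) by rw [hspan]
  apply le_antisymm
  · refine sup_le (vectorSpan_mono ℝ hFT) ?_
    rw [Submodule.span_singleton_le_iff_mem]
    exact vsub_mem_vectorSpan ℝ (subset_convexHull ℝ T hy₀) (subset_convexHull ℝ T hx₀)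
  · rw [vectorSpan_convexHull, vectorSpan_eq_span_vsub_set_right ℝ hx₀, Submodule.span_le]
    rintro _ ⟨x, hx, rfl⟩
    by_contra hmem
    obtain ⟨g, hg, hle⟩ := Submodule.exists_le_ker_of_notMem hmem
    have hgF : ∀ z ∈ T, f z = b → g z = g x₀ := by
      intro z hz hfz
      have : z - x₀ ∈ LinearMap.ker g := hle (Submodule.mem_sup_left
        (vsub_mem_vectorSpan ℝ (⟨subset_convexHull ℝ T hz, hfz⟩ : z ∈ F) hx₀F))
      rwa [LinearMap.mem_ker, map_sub, sub_eq_zero] at this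
    obtain ⟨l, hl⟩ := H g (g x₀) hgF
    have hy : y₀ - x₀ ∈ LinearMap.ker g :=
      hle (Submodule.mem_sup_right (Submodule.mem_span_singleton_self _))
    rw [LinearMap.mem_ker, map_sub, hl y₀ hy₀] at hy
    have hl0 : l = 0 := (mul_eq_zero.1 hy).resolve_right (sub_ne_zero.2 hfy₀)
    apply hg
    simp only [vsub_eq_sub, map_sub]
    rw [hl x hx, hl0, zero_mul]

/-- A face on which a further functional, not determined by the face, is constant has
codimension at least two. -/
theorem adim_face_add_one_ne (hT : T.Finite) {x₀ y₀ y₁ : GPoint}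
    (hx₀ : x₀ ∈ T) (hfx₀ : f x₀ = b) (hy₀ : y₀ ∈ T) (hfy₀ : f y₀ ≠ b) (hy₁ : y₁ ∈ T)
    {g : GPoint →ₗ[ℝ] ℝ} {c : ℝ} (hg : ∀ x ∈ convexHull ℝ T, f x = b → g x = c)
    (hgy₀ : g y₀ = c) (hgy₁ : g y₁ ≠ c) :
    adim {x | x ∈ convexHull ℝ T ∧ f x = b} + 1 ≠ adim (convexHull ℝ T) := by
  unfold adim
  rw [direction_affineSpan, direction_affineSpan]
  set F : Set GPoint := {x | x ∈ convexHull ℝ T ∧ f x = b} with hF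
  have hFT : F ⊆ convexHull ℝ T := fun x hx => hx.1
  have := finiteDimensional_vectorSpan_of_subset_convexHull hT hFT
  have := finiteDimensional_vectorSpan_of_subset_convexHull hT subset_rfl
  have hx₀T := subset_convexHull ℝ T hx₀
  have hv : y₀ - x₀ ∉ vectorSpan ℝ F := by
    intro h
    have := vectorSpan_le_ker (g := f) (c := b) (fun x (hx : x ∈ F) => hx.2) h
    rw [LinearMap.mem_ker, map_sub, hfx₀, sub_eq_zero] at this
    exact hfy₀ this
  rw [← finrank_sup_span_singleton_of_notMem _ hv]
  intro heq
  have hle : vectorSpan ℝ F ⊔ Submodule.span ℝ {y₀ - x₀} ≤ vectorSpan ℝ (convexHull ℝ T) := by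
    refine sup_le (vectorSpan_mono ℝ hFT) ?_
    rw [Submodule.span_singleton_le_iff_mem]
    exact vsub_mem_vectorSpan ℝ (subset_convexHull ℝ T hy₀) hx₀T
  have hker : vectorSpan ℝ F ⊔ Submodule.span ℝ {y₀ - x₀} ≤ LinearMap.ker g := by
    refine sup_le (vectorSpan_le_ker (c := c) fun x hx => hg x hx.1 hx.2) ?_
    rw [Submodule.span_singleton_le_iff_mem, LinearMap.mem_ker, map_sub, hgy₀,
      hg x₀ hx₀T hfx₀, sub_self]
  rw [Submodule.eq_of_le_of_finrank_eq hle heq] at hker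
  have := hker (vsub_mem_vectorSpan ℝ (subset_convexHull ℝ T hy₁) hx₀T)
  rw [LinearMap.mem_ker, vsub_eq_sub, map_sub, hg x₀ hx₀T hfx₀, sub_eq_zero] at this
  exact hgy₁ this

end Dimension

section Labelling

theorem indicator_congr {p q : Prop} {dp : Decidable p} {dq : Decidable q} (h : p ↔ q) :
    (if p then (1 : ℝ) else 0) = if q then 1 else 0 := by
  simp only [h]

open Classical in
/-- The characteristic vector of the partition of `{1,…,n}` into the fibres of a labelling. -/
noncomputable def labelVec {L : Type} (n : ℕ) (f : ℕ → L) : GPoint :=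
  ⟨fun p => if p.1 ∈ Finset.Icc 1 n ∧ p.2 ∈ Finset.Icc 1 n ∧ f p.1 = f p.2 then 1 else 0,
   fun v => if 4 ≤ v ∧ v ∈ Finset.Icc 1 n ∧ ∀ w ∈ Finset.Icc 1 n, f w = f v → v ≤ w
    then 1 else 0⟩

open Classical in
/-- The labelling `f` uses exactly `K` labels on the set `N`. -/
def UsesLabels {L : Type} (N : Finset ℕ) (K : ℕ) (f : ℕ → L) : Prop :=
  (N.image f).card = K

theorem usesLabels_iff {L : Type} [DecidableEq L] {N : Finset ℕ} {K : ℕ} {f : ℕ → L} :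
    UsesLabels N K f ↔ (N.image f).card = K := by
  unfold UsesLabels
  constructor <;> intro h <;> convert h

theorem exists_labelling {n K : ℕ} (π : KPartition n K) :
    ∃ f : ℕ → Finset ℕ, UsesLabels (Finset.Icc 1 n) K f ∧ charVec n K π = labelVec n f := by
  classical
  have hex : ∀ v, ∃ C, v ∈ Finset.Icc 1 n → C ∈ π.parts ∧ v ∈ C := by
    intro v
    by_cases hv : v ∈ Finset.Icc 1 n
    · rw [← π.parts_cover, Finset.mem_sup] at hv
      obtain ⟨C, hC, hvC⟩ := hv
      exact ⟨C, fun _ => ⟨hC, hvC⟩⟩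
    · exact ⟨∅, fun h => absurd h hv⟩
  choose f hf using hex
  have hsub : ∀ C ∈ π.parts, ∀ v ∈ C, v ∈ Finset.Icc 1 n := by
    intro C hC v hv
    rw [← π.parts_cover, Finset.mem_sup]
    exact ⟨C, hC, hv⟩
  have huniq : ∀ C ∈ π.parts, ∀ v ∈ C, f v = C := by
    intro C hC v hv
    by_contra hne
    have h := hf v (hsub C hC v hv)
    exact Finset.disjoint_left.1 (π.parts_disjoint _ h.1 C hC hne) h.2 hv
  have himage : (Finset.Icc 1 n).image f = π.parts := by
    ext C
    rw [Finset.mem_image]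
    constructor
    · rintro ⟨v, hv, rfl⟩
      exact (hf v hv).1
    · intro hC
      obtain ⟨v, hv⟩ := π.parts_nonempty C hC
      exact ⟨v, hsub C hC v hv, huniq C hC v hv⟩
  refine ⟨f, ?_, ?_⟩
  · unfold UsesLabels
    convert π.card_parts
    convert himage
  · unfold charVec labelVec
    refine Prod.ext (funext fun p => ?_) (funext fun v => ?_)
    · refine indicator_congr ⟨?_, ?_⟩
      · rintro ⟨C, hC, h1, h2⟩
        exact ⟨hsub C hC _ h1, hsub C hC _ h2, (huniq C hC _ h1).trans (huniq C hC _ h2).symm⟩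
      · rintro ⟨h1, h2, h⟩
        exact ⟨f p.1, (hf _ h1).1, (hf _ h1).2, h ▸ (hf _ h2).2⟩
    · refine indicator_congr (and_congr_right fun _ => ⟨?_, ?_⟩)
      · rintro ⟨C, hC, h1, h2⟩
        refine ⟨hsub C hC _ h1, fun w hw hwv => h2 w ?_⟩
        rw [← huniq C hC v h1, ← hwv]
        exact (hf w hw).2
      · rintro ⟨h1, h⟩
        refine ⟨f v, (hf v h1).1, (hf v h1).2, fun w hw => ?_⟩
        exact h w (hsub _ (hf v h1).1 w hw) (huniq _ (hf v h1).1 w hw)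

theorem exists_kPartition {L : Type} {n K : ℕ} {f : ℕ → L}
    (hf : UsesLabels (Finset.Icc 1 n) K f) :
    ∃ π : KPartition n K, charVec n K π = labelVec n f := by
  classical
  set fib : L → Finset ℕ := fun l => (Finset.Icc 1 n).filter (fun v => f v = l) with hfib
  have hmem : ∀ l v, v ∈ fib l ↔ v ∈ Finset.Icc 1 n ∧ f v = l := by
    intro l v
    rw [hfib, Finset.mem_filter]
  refine ⟨⟨((Finset.Icc 1 n).image f).image fib, ?_, ?_, ?_, ?_⟩, ?_⟩
  · rw [Finset.card_image_of_injOn]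
    · unfold UsesLabels at hf
      convert hf
    · intro l hl m hm hlm
      obtain ⟨v, hv, rfl⟩ := Finset.mem_image.1 (Finset.mem_coe.1 hl)
      exact ((hmem m v).1 (hlm ▸ (hmem (f v) v).2 ⟨hv, rfl⟩)).2
  · intro C hC
    simp only [Finset.mem_image] at hC
    obtain ⟨_, ⟨v, hv, rfl⟩, rfl⟩ := hC
    exact ⟨v, (hmem _ v).2 ⟨hv, rfl⟩⟩
  · intro C hC D hD hCD
    obtain ⟨l, -, rfl⟩ := Finset.mem_image.1 hC
    obtain ⟨m, -, rfl⟩ := Finset.mem_image.1 hD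
    rw [Finset.disjoint_left]
    intro v hvl hvm
    rw [hmem] at hvl hvm
    exact hCD (by rw [← hvl.2, ← hvm.2])
  · ext v
    simp only [Finset.mem_sup, Finset.mem_image, id]
    constructor
    · rintro ⟨_, ⟨l, -, rfl⟩, h⟩
      exact ((hmem _ _).1 h).1
    · intro hv
      exact ⟨_, ⟨_, ⟨v, hv, rfl⟩, rfl⟩, (hmem _ _).2 ⟨hv, rfl⟩⟩
  · unfold charVec labelVec
    refine Prod.ext (funext fun p => ?_) (funext fun v => ?_)
    · refine indicator_congr ⟨?_, ?_⟩
      · rintro ⟨C, hC, h1, h2⟩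
        obtain ⟨l, -, rfl⟩ := Finset.mem_image.1 hC
        rw [hmem] at h1 h2
        exact ⟨h1.1, h2.1, h1.2.trans h2.2.symm⟩
      · rintro ⟨h1, h2, h⟩
        exact ⟨fib (f p.1), Finset.mem_image_of_mem _ (Finset.mem_image_of_mem _ h1),
          (hmem _ _).2 ⟨h1, rfl⟩, (hmem _ _).2 ⟨h2, h.symm⟩⟩
    · refine indicator_congr (and_congr_right fun _ => ⟨?_, ?_⟩)
      · rintro ⟨C, hC, h1, h2⟩
        obtain ⟨l, -, rfl⟩ := Finset.mem_image.1 hC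
        rw [hmem] at h1
        exact ⟨h1.1, fun w hw hwv => h2 w ((hmem _ _).2 ⟨hw, hwv.trans h1.2⟩)⟩
      · rintro ⟨h1, h⟩
        refine ⟨fib (f v), Finset.mem_image_of_mem _ (Finset.mem_image_of_mem _ h1),
          (hmem _ _).2 ⟨h1, rfl⟩, fun w hw => ?_⟩
        rw [hmem] at hw
        exact h w hw.1 hw.2

theorem finite_charVecs (n K : ℕ) : {x | ∃ π : KPartition n K, x = charVec n K π}.Finite := by
  have hfin : Finite (KPartition n K) := by
    refine Finite.of_injective
      (fun π : KPartition n K => (⟨π.parts, ?_⟩ : {P // P ∈ (Finset.Icc 1 n).powerset.powerset}))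
      ?_
    · rw [Finset.mem_powerset]
      intro C hC
      rw [Finset.mem_powerset, ← π.parts_cover]
      exact Finset.le_sup (f := id) hC
    · rintro ⟨P, _, _, _, _⟩ ⟨Q, _, _, _, _⟩ h
      simpa using h
  refine (Set.finite_range (charVec n K)).subset ?_
  rintro _ ⟨π, rfl⟩
  exact ⟨π, rfl⟩

/-- The coordinate vector of the ordered pair `(p, q)`. -/
noncomputable def edgeVec (p q : ℕ) : GPoint := (Pi.single (p, q) 1, 0)

/-- The coordinate vector of the representative component of `v`, zero when there is none. -/
noncomputable def repVec (v : ℕ) : GPoint := if 4 ≤ v then (0, Pi.single v 1) else 0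

theorem repVec_snd (x v : ℕ) : (repVec x).2 v = if 4 ≤ v ∧ v = x then 1 else 0 := by
  unfold repVec
  by_cases hx : v = x
  · subst hx
    by_cases h : 4 ≤ v <;> simp [h]
  · by_cases h : 4 ≤ x <;> simp [h, hx]

/-- The labelling `f` with the labels of `u` and `w` changed to `x` and `y`. -/
def relabel {L : Type} (f : ℕ → L) (u w : ℕ) (x y : L) : ℕ → L :=
  fun v => if v = u then x else if v = w then y else f v

open Classical in
theorem labelVec_relabel_snd {L : Type} {n u w : ℕ} (f : ℕ → L) (hu : u ∈ Finset.Icc 1 n)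
    (hw : w ∈ Finset.Icc 1 n) (huw : u ≠ w) (x y : L) (v : ℕ) :
    (labelVec n (relabel f u w x y)).2 v =
      if 4 ≤ v ∧ v ∈ Finset.Icc 1 n ∧
        (∀ z ∈ Finset.Icc 1 n, z ≠ u → z ≠ w → f z = relabel f u w x y v → v ≤ z) ∧
        (x = relabel f u w x y v → v ≤ u) ∧ (y = relabel f u w x y v → v ≤ w) then 1 else 0 := by
  simp only [labelVec]
  refine indicator_congr (and_congr_right fun _ => and_congr_right fun _ => ?_)
  constructor
  · intro h
    refine ⟨fun z hz hzu hzw hfz => h z hz (by simpa [relabel, hzu, hzw] using hfz),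
      fun hx => h u hu ?_, fun hy => h w hw ?_⟩
    · rw [← hx]; simp [relabel]
    · rw [← hy]; simp [relabel, huw.symm]
  · rintro ⟨h1, h2, h3⟩ z hz hfz
    by_cases hzu : z = u
    · subst hzu; exact h2 (by simpa [relabel] using hfz)
    by_cases hzw : z = w
    · subst hzw; exact h3 (by simpa [relabel, hzu] using hfz)
    exact h1 z hz hzu hzw (by simpa [relabel, hzu, hzw] using hfz)

theorem labelVec_four_cycle {L : Type} {n u w a : ℕ} (f : ℕ → L) {i j k : L}
    (hu : u ∈ Finset.Icc 1 n) (hw : w ∈ Finset.Icc 1 n) (huw : u ≠ w)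
    (hij : i ≠ j) (hik : i ≠ k) (hjk : j ≠ k)
    (ha : a ∈ Finset.Icc 1 n) (hau : a ≠ u) (haw : a ≠ w) (hfa : f a = i)
    (hmin : ∀ x ∈ Finset.Icc 1 n, x ≠ u → x ≠ w → f x = i → a ≤ x) :
    labelVec n (relabel f u w i i) - labelVec n (relabel f u w i j) -
      labelVec n (relabel f u w k i) + labelVec n (relabel f u w k j) =
    edgeVec u w + edgeVec w u +
      (if u < a ∧ w < a then repVec a - repVec (max u w) else 0) := by
  classical
  refine Prod.ext (funext fun p => ?_) (funext fun v => ?_)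
  · obtain ⟨p, q⟩ := p
    have h0 : (if u < a ∧ w < a then repVec a - repVec (max u w) else 0 : GPoint).1 (p, q) = 0 := by
      unfold repVec
      split_ifs <;> simp
    simp only [Prod.fst_add, Prod.fst_sub, Pi.add_apply, Pi.sub_apply, h0]
    simp only [labelVec, edgeVec, relabel, Pi.single_apply, Prod.mk.injEq]
    grind
  · have h0 : (if u < a ∧ w < a then repVec a - repVec (max u w) else 0 : GPoint).2 v =
        if u < a ∧ w < a then (if 4 ≤ v ∧ v = a then 1 else 0) -
          (if 4 ≤ v ∧ v = max u w then 1 else 0) else 0 := by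
      by_cases h : u < a ∧ w < a
      · rw [if_pos h, if_pos h, Prod.snd_sub, Pi.sub_apply, repVec_snd, repVec_snd]
      · rw [if_neg h, if_neg h]
        rfl
    simp only [Prod.snd_add, Prod.snd_sub, Pi.add_apply, Pi.sub_apply, h0,
      labelVec_relabel_snd f hu hw huw]
    simp only [edgeVec, Pi.zero_apply]
    have hMa : ∀ x, x ≠ u → x ≠ w → x ∈ Finset.Icc 1 n → f x = i →
        ((∀ z ∈ Finset.Icc 1 n, z ≠ u → z ≠ w → f z = i → x ≤ z) ↔ x = a) := by
      intro x hxu hxw hx hfx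
      exact ⟨fun h => le_antisymm (h a ha hau haw hfa) (hmin x hx hxu hxw hfx),
        fun h => h ▸ hmin⟩
    have hMle : ∀ x, (∀ z ∈ Finset.Icc 1 n, z ≠ u → z ≠ w → f z = i → x ≤ z) ↔ x ≤ a :=
      fun x => ⟨fun h => h a ha hau haw hfa,
        fun h z hz hzu hzw hfz => h.trans (hmin z hz hzu hzw hfz)⟩
    by_cases hvu : v = u
    · subst hvu
      simp only [relabel, if_true, hij.symm, hik, hjk, hMle,
        false_imp_iff, true_imp_iff, le_refl, true_and, and_true, hu]
      clear h0 hMa hMle hmin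
      split_ifs <;> norm_num
      all_goals grind
    by_cases hvw : v = w
    · subst hvw
      simp only [relabel, if_true, hvu, if_false, hij, hik.symm, hjk.symm,
        hMle, false_imp_iff, true_imp_iff, le_refl, true_and, and_true, hw]
      clear h0 hMa hMle hmin
      split_ifs <;> norm_num
      all_goals grind
    simp only [relabel, hvu, hvw, if_false]
    have hmax : v ≠ max u w := by
      rcases max_choice u w with h | h <;> rw [h] <;> assumption
    by_cases hv : v ∈ Finset.Icc 1 n
    · by_cases hfv : f v = i
      · simp only [hfv, hMa v hvu hvw hv hfv, hij.symm, hik.symm, hmax, and_false, if_false,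
          false_imp_iff, true_imp_iff, true_and, and_true, hv]
        clear h0 hMa hMle hmin
        split_ifs <;> norm_num
        all_goals grind
      · have hva : v ≠ a := fun h => hfv (h ▸ hfa)
        simp only [hv, true_and, Ne.symm hfv, false_imp_iff, hva, hmax, and_false, if_false,
          sub_zero, ite_self, add_zero]
        by_cases hj : f v = j
        · simp only [hj, hjk.symm, false_imp_iff, and_true, true_and]
          ring
        · simp only [Ne.symm hj, false_imp_iff, and_true]
          ring
    · have hva : v ≠ a := fun h => hv (h ▸ ha)
      simp only [hv, false_and, and_false, if_false, hva, hmax]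
      norm_num

end Labelling

section Functional

variable {n K s t₁ t₂ u w : ℕ} {L : Type} {f : ℕ → L} {g : GPoint →ₗ[ℝ] ℝ} {c : ℝ}

/-- The vertex `v` is the smallest one carrying its label. -/
def IsRep (n : ℕ) (f : ℕ → L) (v : ℕ) : Prop := ∀ x ∈ Finset.Icc 1 n, f x = f v → v ≤ x

theorem labelVec_fst (hu : u ∈ Finset.Icc 1 n) (hw : w ∈ Finset.Icc 1 n) [Decidable (f u = f w)] :
    (labelVec n f).1 (u, w) = if f u = f w then 1 else 0 :=
  indicator_congr ⟨fun h => h.2.2, fun h => ⟨hu, hw, h⟩⟩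

theorem labelVec_snd [Decidable (4 ≤ s ∧ s ∈ Finset.Icc 1 n ∧ IsRep n f s)] :
    (labelVec n f).2 s = if 4 ≤ s ∧ s ∈ Finset.Icc 1 n ∧ IsRep n f s then 1 else 0 :=
  indicator_congr Iff.rfl

/-- The edge coordinate `x_{p,q}` as a linear functional. -/
def edgeL (p q : ℕ) : GPoint →ₗ[ℝ] ℝ :=
  (LinearMap.proj (p, q)).comp (LinearMap.fst ℝ (ℕ × ℕ → ℝ) (ℕ → ℝ))

/-- The representative coordinate `x_v` as a linear functional. -/
def repL (v : ℕ) : GPoint →ₗ[ℝ] ℝ :=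
  (LinearMap.proj v).comp (LinearMap.snd ℝ (ℕ × ℕ → ℝ) (ℕ → ℝ))

@[simp] theorem edgeL_apply (p q : ℕ) (x : GPoint) : edgeL p q x = x.1 (p, q) := rfl

@[simp] theorem repL_apply (v : ℕ) (x : GPoint) : repL v x = x.2 v := rfl

/-- The left-hand side of the strengthened triangle inequality. -/
def triangle (s t₁ t₂ : ℕ) : GPoint →ₗ[ℝ] ℝ := edgeL s t₁ + edgeL s t₂ - edgeL t₁ t₂ + repL s

theorem triangle_apply (s t₁ t₂ : ℕ) (x : GPoint) :
    triangle s t₁ t₂ x = x.1 (s, t₁) + x.1 (s, t₂) - x.1 (t₁, t₂) + x.2 s := rfl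

/-- The partition into the fibres of `f` satisfies the strengthened triangle inequality with
equality. -/
def OnFace (n s t₁ t₂ : ℕ) (f : ℕ → L) : Prop :=
  f s = f t₁ ∨ f s = f t₂ ∨ (f t₁ ≠ f t₂ ∧ IsRep n f s)

theorem triangle_labelVec_le_and_eq_iff (hs : s ∈ Finset.Icc 1 n) (ht₁ : t₁ ∈ Finset.Icc 1 n)
    (ht₂ : t₂ ∈ Finset.Icc 1 n) (h₁ : t₁ < t₂) (h₂ : t₂ < s) (h₃ : 4 ≤ s) (f : ℕ → L) :
    triangle s t₁ t₂ (labelVec n f) ≤ 1 ∧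
      (triangle s t₁ t₂ (labelVec n f) = 1 ↔ OnFace n s t₁ t₂ f) := by
  classical
  have hrep₁ : f s = f t₁ → ¬ IsRep n f s := fun h hr =>
    absurd (hr t₁ ht₁ h.symm) (by omega)
  have hrep₂ : f s = f t₂ → ¬ IsRep n f s := fun h hr =>
    absurd (hr t₂ ht₂ h.symm) (by omega)
  rw [triangle_apply, labelVec_fst hs ht₁, labelVec_fst hs ht₂, labelVec_fst ht₁ ht₂,
    labelVec_snd]
  unfold OnFace
  simp only [h₃, hs, true_and]
  by_cases hst₁ : f s = f t₁
  · by_cases hst₂ : f s = f t₂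
    · have : f t₁ = f t₂ := hst₁.symm.trans hst₂
      simp [hrep₁ hst₁, hst₁, this]
    · have : f t₁ ≠ f t₂ := fun h => hst₂ (hst₁.trans h)
      simp [hrep₁ hst₁, hst₁, this]
  · by_cases hst₂ : f s = f t₂
    · have : f t₁ ≠ f t₂ := fun h => hst₁ (hst₂.trans h.symm)
      simp [hrep₂ hst₂, hst₂, this, Ne.symm this]
    · by_cases ht : f t₁ = f t₂ <;> by_cases hmin : IsRep n f s <;> norm_num [hst₁, hst₂, ht, hmin]

open Classical in
theorem map_labelVec (g : GPoint →ₗ[ℝ] ℝ) (n : ℕ) (f : ℕ → L) :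
    g (labelVec n f) =
      (∑ p ∈ Finset.Icc 1 n, ∑ q ∈ Finset.Icc 1 n, if f p = f q then g (edgeVec p q) else 0) +
      ∑ v ∈ Finset.Icc 1 n,
        if IsRep n f v then g (repVec v) else 0 := by
  have h : labelVec n f =
      (∑ p ∈ Finset.Icc 1 n, ∑ q ∈ Finset.Icc 1 n, if f p = f q then edgeVec p q else 0) +
      ∑ v ∈ Finset.Icc 1 n,
        if IsRep n f v then repVec v else 0 := by
    have hrep : ∀ v, (repVec v).1 = 0 := by
      intro v
      unfold repVec
      split_ifs <;> rfl
    refine Prod.ext (funext fun ⟨p, q⟩ => ?_) (funext fun v => ?_)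
    · simp only [Prod.fst_add, Prod.fst_sum, Pi.add_apply, Finset.sum_apply,
        apply_ite Prod.fst, hrep, ite_self, Prod.fst_zero, Finset.sum_const_zero, add_zero,
        Pi.zero_apply]
      have : ∀ a b, (if f a = f b then (edgeVec a b).1 else 0 : ℕ × ℕ → ℝ) (p, q) =
          if p = a then (if q = b then (if f p = f q then 1 else 0) else 0) else 0 := by
        intro a b
        by_cases ha : p = a
        · by_cases hb : q = b
          · subst ha hb
            by_cases hf : f p = f q <;> simp [hf, edgeVec]
          · by_cases hf : f a = f b <;> simp [hf, edgeVec, hb]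
        · by_cases hf : f a = f b <;> simp [hf, edgeVec, ha]
      simp only [this, labelVec]
      by_cases hp : p ∈ Finset.Icc 1 n <;> by_cases hq : q ∈ Finset.Icc 1 n <;>
        simp only [hp, hq, Finset.sum_ite_eq, Finset.sum_const_zero, Finset.sum_ite_irrel, if_true,
          if_false, true_and, false_and, ite_self]
    · simp only [Prod.snd_add, Prod.snd_sum, Pi.add_apply, Finset.sum_apply,
        apply_ite Prod.snd, edgeVec, ite_self, Prod.snd_zero, Finset.sum_const_zero, zero_add,
        Pi.zero_apply]
      have : ∀ a, (if IsRep n f a then (repVec a).2 else 0 : ℕ → ℝ) v =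
          if v = a then (if 4 ≤ v ∧ IsRep n f v then 1 else 0)
          else 0 := by
        intro a
        rw [apply_ite (fun z : ℕ → ℝ => z v), repVec_snd]
        by_cases ha : v = a
        · subst ha
          rw [if_pos rfl]
          split_ifs <;> first | rfl | (exfalso; tauto)
        · simp [ha]
      simp only [this, labelVec_snd]
      by_cases hv : v ∈ Finset.Icc 1 n <;>
        simp only [hv, Finset.sum_ite_eq, if_true, if_false, true_and, false_and, and_false]
  rw [h, map_add, map_sum, map_sum]
  simp only [map_sum, apply_ite g, map_zero]

theorem map_labelVec_of_vanishing {h : GPoint →ₗ[ℝ] ℝ}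
    (hedge : ∀ p ∈ Finset.Icc 1 n, ∀ q ∈ Finset.Icc 1 n, p ≠ q →
      h (edgeVec p q) + h (edgeVec q p) = 0)
    (hrep : ∀ v ∈ Finset.Icc 1 n, h (repVec v) = 0) (f : ℕ → L) :
    h (labelVec n f) = ∑ p ∈ Finset.Icc 1 n, h (edgeVec p p) := by
  classical
  rw [map_labelVec]
  have hr : (∑ v ∈ Finset.Icc 1 n,
      if IsRep n f v then h (repVec v) else 0) = 0 :=
    Finset.sum_eq_zero fun v hv => by rw [hrep v hv, ite_self]
  rw [hr, add_zero]
  set S := ∑ p ∈ Finset.Icc 1 n, ∑ q ∈ Finset.Icc 1 n, if f p = f q then h (edgeVec p q) else 0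
    with hS
  have hcomm : S = ∑ p ∈ Finset.Icc 1 n, ∑ q ∈ Finset.Icc 1 n,
      if f p = f q then h (edgeVec q p) else 0 := by
    rw [hS, Finset.sum_comm]
    refine Finset.sum_congr rfl fun p _ => Finset.sum_congr rfl fun q _ => ?_
    simp only [eq_comm]
  have hdouble : S + S = 2 * ∑ p ∈ Finset.Icc 1 n, h (edgeVec p p) := by
    nth_rewrite 2 [hcomm]
    rw [hS, ← Finset.sum_add_distrib, Finset.mul_sum]
    refine Finset.sum_congr rfl fun p hp => ?_
    rw [← Finset.sum_add_distrib, Finset.sum_eq_single_of_mem p hp]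
    · simp only [if_true]; ring
    · intro q hq hqp
      split_ifs
      · exact hedge p hp q hq hqp.symm
      · ring
  linarith

/-- The functional `g` takes the value `c` on all vertices of the face. -/
def ConstOnFace (n K s t₁ t₂ : ℕ) (g : GPoint →ₗ[ℝ] ℝ) (c : ℝ) : Prop :=
  ∀ (L : Type) (f : ℕ → L), UsesLabels (Finset.Icc 1 n) K f → OnFace n s t₁ t₂ f →
    g (labelVec n f) = c

/-- The value of `g` on the four-cycle exchanging `u` and `w` with a cluster of minimum `a`
vanishes. -/
def VanishesOnFourCycle (g : GPoint →ₗ[ℝ] ℝ) (u w a : ℕ) : Prop :=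
  g (edgeVec u w) + g (edgeVec w u) +
    (if u < a ∧ w < a then g (repVec a) - g (repVec (max u w)) else 0) = 0

theorem UsesLabels.relabel (huw : u ≠ w)
    (hf : UsesLabels (Finset.Icc 1 n \ {u, w}) K f) {a b : ℕ}
    (ha : a ∈ Finset.Icc 1 n \ {u, w}) (hb : b ∈ Finset.Icc 1 n \ {u, w}) :
    UsesLabels (Finset.Icc 1 n) K (relabel f u w (f a) (f b)) := by
  unfold UsesLabels at hf ⊢
  rw [← hf]
  congr 1
  ext l
  simp only [Finset.mem_image]
  constructor
  · rintro ⟨v, hv, rfl⟩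
    unfold StrengthenedTriangle.relabel
    by_cases hvu : v = u
    · exact ⟨a, ha, by simp [hvu]⟩
    by_cases hvw : v = w
    · exact ⟨b, hb, by simp [hvw, huw.symm]⟩
    exact ⟨v, by simp [hvu, hvw, Finset.mem_Icc.1 hv], by simp [hvu, hvw]⟩
  · rintro ⟨v, hv, rfl⟩
    rw [Finset.mem_sdiff, Finset.mem_insert, Finset.mem_singleton, not_or] at hv
    exact ⟨v, hv.1, by simp [StrengthenedTriangle.relabel, hv.2.1, hv.2.2]⟩

theorem ConstOnFace.vanishesOnFourCycle (hg : ConstOnFace n K s t₁ t₂ g c)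
    (hu : u ∈ Finset.Icc 1 n) (hw : w ∈ Finset.Icc 1 n) (huw : u ≠ w)
    (hf : UsesLabels (Finset.Icc 1 n \ {u, w}) K f) {a b d : ℕ}
    (ha : a ∈ Finset.Icc 1 n \ {u, w}) (hb : b ∈ Finset.Icc 1 n \ {u, w})
    (hd : d ∈ Finset.Icc 1 n \ {u, w}) (hab : f a ≠ f b) (had : f a ≠ f d) (hbd : f b ≠ f d)
    (hmin : ∀ x ∈ Finset.Icc 1 n \ {u, w}, f x = f a → a ≤ x)
    (hface : ∀ x y, (x = f a ∨ x = f d) → (y = f a ∨ y = f b) →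
      OnFace n s t₁ t₂ (relabel f u w x y)) :
    VanishesOnFourCycle g u w a := by
  have h1 := hg L _ (hf.relabel huw ha ha) (hface _ _ (.inl rfl) (.inl rfl))
  have h2 := hg L _ (hf.relabel huw ha hb) (hface _ _ (.inl rfl) (.inr rfl))
  have h3 := hg L _ (hf.relabel huw hd ha) (hface _ _ (.inr rfl) (.inl rfl))
  have h4 := hg L _ (hf.relabel huw hd hb) (hface _ _ (.inr rfl) (.inr rfl))
  have ha' := ha
  rw [Finset.mem_sdiff, Finset.mem_insert, Finset.mem_singleton, not_or] at ha'
  have hcycle := congrArg g (labelVec_four_cycle f hu hw huw hab had hbd ha'.1 ha'.2.1 ha'.2.2 rfl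
    (fun x hx hxu hxw => hmin x (by simp [hxu, hxw, Finset.mem_Icc.1 hx])))
  simp only [map_add, map_sub, h1, h2, h3, h4, apply_ite g, map_zero] at hcycle
  unfold VanishesOnFourCycle
  linarith

end Functional

section Extension

/-- A labelling of part of a vertex set by `0,…,k-1` extends to a labelling with `K` labels in
which every other vertex either forms a singleton or carries the label `c₀`. -/
theorem exists_extension {N D : Finset ℕ} {K k c₀ : ℕ} (hDN : D ⊆ N) {f₀ : ℕ → ℕ}
    (himage : D.image f₀ = Finset.range k) (hc₀ : c₀ < k) (hkK : k ≤ K)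
    (hK : K + D.card ≤ N.card + k) :
    ∃ f : ℕ → ℕ ⊕ ℕ, UsesLabels N K f ∧ (∀ x ∈ D, f x = .inl (f₀ x)) ∧
      ∀ x ∉ D, f x = .inl c₀ ∨ f x = .inr x := by
  classical
  have hcard : K - k ≤ (N \ D).card := by
    rw [Finset.card_sdiff_of_subset hDN]
    omega
  obtain ⟨T, hT, hTcard⟩ := Finset.exists_subset_card_eq hcard
  refine ⟨fun x => if x ∈ D then .inl (f₀ x) else if x ∈ T then .inr x else .inl c₀, ?_,
    fun x hx => by simp [hx], fun x hx => by by_cases h : x ∈ T <;> simp [hx, h]⟩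
  unfold UsesLabels
  have : N.image (fun x => if x ∈ D then (.inl (f₀ x) : ℕ ⊕ ℕ) else
      if x ∈ T then .inr x else .inl c₀) = (Finset.range k).disjSum T := by
    ext l
    rw [Finset.mem_image, ← himage]
    rw [← Finset.mem_range, ← himage, Finset.mem_image] at hc₀
    constructor
    · rintro ⟨x, hx, rfl⟩
      by_cases hxD : x ∈ D
      · simp only [hxD, if_true, Finset.inl_mem_disjSum]
        exact Finset.mem_image_of_mem _ hxD
      by_cases hxT : x ∈ T
      · simp [hxD, hxT]
      · simpa [hxD, hxT] using hc₀
    · rw [Finset.mem_disjSum]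
      rintro (⟨i, hi, rfl⟩ | ⟨x, hx, rfl⟩)
      · obtain ⟨x, hx, rfl⟩ := Finset.mem_image.1 hi
        exact ⟨x, hDN hx, by simp [hx]⟩
      · have := Finset.mem_sdiff.1 (hT hx)
        exact ⟨x, this.1, by simp [this.2, hx]⟩
  convert (congrArg Finset.card this).trans _
  rw [Finset.card_disjSum, Finset.card_range, hTcard]
  omega

variable {n K s t₁ t₂ u w : ℕ} {g : GPoint →ₗ[ℝ] ℝ} {c : ℝ}

theorem ConstOnFace.vanishes_of_extension (hg : ConstOnFace n K s t₁ t₂ g c)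
    (hu : u ∈ Finset.Icc 1 n) (hw : w ∈ Finset.Icc 1 n) (huw : u ≠ w)
    {D : Finset ℕ} (hD : D ⊆ Finset.Icc 1 n \ {u, w}) {f₀ : ℕ → ℕ}
    (himage : D.image f₀ = Finset.range 3) (hK₁ : 3 ≤ K) (hK₂ : K + D.card ≤ n + 1)
    {a b d : ℕ} (ha : a ∈ D) (hb : b ∈ D) (hd : d ∈ D) (hfa : f₀ a = 0) (hfb : f₀ b = 1)
    (hfd : f₀ d = 2) (hmin : ∀ x ∈ D, f₀ x = 0 → a ≤ x)
    (hface : ∀ f : ℕ → ℕ ⊕ ℕ, (∀ x ∈ D, f x = .inl (f₀ x)) → ∀ x y, (y = f a ∨ y = f b) →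
      OnFace n s t₁ t₂ (relabel f u w x y)) :
    VanishesOnFourCycle g u w a := by
  have hcard : (Finset.Icc 1 n \ {u, w}).card + 2 = n := by
    rw [Finset.card_sdiff_of_subset (by simp [Finset.insert_subset_iff, Finset.mem_Icc.1 hu,
      Finset.mem_Icc.1 hw]), Finset.card_pair huw, Nat.card_Icc]
    have := Finset.mem_Icc.1 hu
    have := Finset.mem_Icc.1 hw
    omega
  obtain ⟨f, hf, hfD, hfN⟩ := exists_extension (c₀ := 2) hD himage (by norm_num) hK₁ (by omega)
  refine hg.vanishesOnFourCycle hu hw huw hf (hD ha) (hD hb) (hD hd) ?_ ?_ ?_ ?_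
    fun x y _ hy => hface f hfD x y hy
  · simp [hfD, ha, hb, hfa, hfb]
  · simp [hfD, ha, hd, hfa, hfd]
  · simp [hfD, hb, hd, hfb, hfd]
  · intro x _ hx
    rw [hfD a ha, hfa] at hx
    by_cases hxD : x ∈ D
    · rw [hfD x hxD] at hx
      exact hmin x hxD (Sum.inl_injective hx)
    · rcases hfN x hxD with h | h <;> simp [h] at hx

theorem exists_mem_Icc_notMem {S : Finset ℕ} (hS : S.card < n) : ∃ y ∈ Finset.Icc 1 n, y ∉ S :=
  Finset.exists_mem_notMem_of_card_lt_card (by rwa [Nat.card_Icc, Nat.add_sub_cancel])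

/-- Edges joining `s` to a vertex outside the triangle. -/
theorem ConstOnFace.vanishes_apex (hg : ConstOnFace n K s t₁ t₂ g c) (hn : 5 ≤ n) (hK₁ : 3 ≤ K)
    (hK₂ : K ≤ n - 2) (hs : s ∈ Finset.Icc 1 n) (ht₁ : t₁ ∈ Finset.Icc 1 n)
    (ht₂ : t₂ ∈ Finset.Icc 1 n) (h₁ : t₁ < t₂) (h₂ : t₂ < s)
    (hu : u ∈ Finset.Icc 1 n) (hus : u ≠ s) (hut₁ : u ≠ t₁) (hut₂ : u ≠ t₂) :
    VanishesOnFourCycle g u s t₁ := by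
  obtain ⟨y, hy, hyS⟩ := exists_mem_Icc_notMem (n := n) (S := {u, s, t₁, t₂})
    (Finset.card_le_four.trans_lt (by omega))
  simp only [Finset.mem_insert, Finset.mem_singleton, not_or] at hyS
  obtain ⟨hyu, hys, hyt₁, hyt₂⟩ := hyS
  have hD : ({t₁, t₂, y} : Finset ℕ) ⊆ Finset.Icc 1 n \ {u, s} := by
    simp only [Finset.insert_subset_iff, Finset.singleton_subset_iff, Finset.mem_sdiff,
      Finset.mem_insert, Finset.mem_singleton, not_or]
    exact ⟨⟨ht₁, hut₁.symm, by omega⟩, ⟨ht₂, hut₂.symm, h₂.ne⟩, ⟨hy, hyu, hys⟩⟩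
  have hcard : ({t₁, t₂, y} : Finset ℕ).card ≤ 3 := Finset.card_le_three
  refine hg.vanishes_of_extension (b := t₂) (d := y)
    (f₀ := fun x => if x = t₁ then 0 else if x = t₂ then 1 else 2) hu hs hus hD
    ?_ hK₁ (by omega) (by simp) (by simp) (by simp) (by simp) (by simp [h₁.ne']) (by simp [*])
    (by simp [h₁.ne', hyt₁, hyt₂]) ?_
  · simp [Finset.image_insert, h₁.ne', hyt₁, hyt₂]
    decide
  · intro f hf x z hz
    have hs' : relabel f u s x z s = z := by simp [relabel, hus.symm]
    have ht₁' : relabel f u s x z t₁ = f t₁ := by simp [relabel, hut₁.symm, (h₁.trans h₂).ne]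
    have ht₂' : relabel f u s x z t₂ = f t₂ := by simp [relabel, hut₂.symm, h₂.ne]
    rw [OnFace, hs', ht₁', ht₂']
    tauto

/-- Cycles avoiding `s`, with `s` attached to one of its two neighbours. -/
theorem ConstOnFace.vanishes_of_le_sub_three (hg : ConstOnFace n K s t₁ t₂ g c) (hn : 5 ≤ n)
    (hK₁ : 3 ≤ K) (hK₂ : K ≤ n - 3) (hs : s ∈ Finset.Icc 1 n)
    (hu : u ∈ Finset.Icc 1 n) (hw : w ∈ Finset.Icc 1 n) (huw : u ≠ w) (hus : u ≠ s) (hws : w ≠ s)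
    {t : ℕ} (ht : t = t₁ ∨ t = t₂) (htn : t ∈ Finset.Icc 1 n) (hts : t < s) (htu : t ≠ u)
    (htw : t ≠ w) {v : ℕ} (hv : v ∈ Finset.Icc 1 n) (hvu : v ≠ u) (hvw : v ≠ w) (hvs : v ≠ s) :
    VanishesOnFourCycle g u w v := by
  have hface : ∀ f : ℕ → ℕ ⊕ ℕ, f s = f t → ∀ x y, OnFace n s t₁ t₂ (relabel f u w x y) := by
    intro f hf x y
    have : relabel f u w x y s = relabel f u w x y t := by
      simp [relabel, hus.symm, hws.symm, htu, htw, hf]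
    rcases ht with rfl | rfl
    · exact .inl this
    · exact .inr (.inl this)
  obtain ⟨z, hz, hzS⟩ := exists_mem_Icc_notMem (n := n) (S := {u, w, v, s, t})
    (Finset.card_le_five.trans_lt (by omega))
  simp only [Finset.mem_insert, Finset.mem_singleton, not_or] at hzS
  obtain ⟨hzu, hzw, hzv, hzs, hzt⟩ := hzS
  obtain rfl | htv := eq_or_ne t v
  · obtain ⟨y, hy, hyS⟩ := exists_mem_Icc_notMem (n := n) (S := {u, w, t, s, z})
      (Finset.card_le_five.trans_lt (by omega))
    simp only [Finset.mem_insert, Finset.mem_singleton, not_or] at hyS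
    obtain ⟨hyu, hyw, hyt, hys, hyz⟩ := hyS
    have hD : ({t, s, z, y} : Finset ℕ) ⊆ Finset.Icc 1 n \ {u, w} := by
      simp only [Finset.insert_subset_iff, Finset.singleton_subset_iff, Finset.mem_sdiff,
        Finset.mem_insert, Finset.mem_singleton, not_or]
      exact ⟨⟨hv, hvu, hvw⟩, ⟨hs, hus.symm, hws.symm⟩, ⟨hz, hzu, hzw⟩, ⟨hy, hyu, hyw⟩⟩
    have hcard : ({t, s, z, y} : Finset ℕ).card ≤ 4 := Finset.card_le_four
    refine hg.vanishes_of_extension (b := z) (d := y)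
      (f₀ := fun x => if x = t ∨ x = s then 0 else if x = z then 1 else 2) hu hw huw hD
      ?_ hK₁ (by omega) (by simp) (by simp) (by simp) (by simp) (by simp [*]) (by simp [*])
      (by simp [*, hts.le]) ?_
    · simp [Finset.image_insert, *]
      decide
    · exact fun f hf x y _ => hface f (by simp [hf]) x y
  · have hD : ({v, z, s, t} : Finset ℕ) ⊆ Finset.Icc 1 n \ {u, w} := by
      simp only [Finset.insert_subset_iff, Finset.singleton_subset_iff, Finset.mem_sdiff,
        Finset.mem_insert, Finset.mem_singleton, not_or]
      exact ⟨⟨hv, hvu, hvw⟩, ⟨hz, hzu, hzw⟩, ⟨hs, hus.symm, hws.symm⟩, ⟨htn, htu, htw⟩⟩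
    have hcard : ({v, z, s, t} : Finset ℕ).card ≤ 4 := Finset.card_le_four
    have hzt' := Ne.symm hzt
    have hzs' := Ne.symm hzs
    refine hg.vanishes_of_extension (b := z) (d := s)
      (f₀ := fun x => if x = v then 0 else if x = z then 1 else 2) hu hw huw hD
      ?_ hK₁ (by omega) (by simp) (by simp) (by simp) (by simp) (by simp [*]) ?_ ?_ ?_
    · simp [Finset.image_insert, *, hvs.symm]
      decide
    · simp [*, hvs.symm]
    · simp [*, hvs.symm]
    · exact fun f hf x y _ => hface f (by simp [*, hvs.symm]) x y

end Extension

section Singletons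

variable {n K s t₁ t₂ u w v : ℕ} {g : GPoint →ₗ[ℝ] ℝ} {c : ℝ}

theorem VanishesOnFourCycle.symm (h : VanishesOnFourCycle g u w v) :
    VanishesOnFourCycle g w u v := by
  unfold VanishesOnFourCycle at h ⊢
  rw [max_comm, add_comm (g (edgeVec w u))]
  simpa only [and_comm] using h

/-- When `K = n - 2`, cycles whose remaining vertices are all singletons. -/
theorem ConstOnFace.vanishes_of_singletons (hg : ConstOnFace n K s t₁ t₂ g c) (hK : K + 2 = n)
    (hu : u ∈ Finset.Icc 1 n) (hw : w ∈ Finset.Icc 1 n) (huw : u ≠ w)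
    (hus : u ≠ s) (hws : w ≠ s) {z y : ℕ} (hv : v ∈ Finset.Icc 1 n \ {u, w})
    (hz : z ∈ Finset.Icc 1 n \ {u, w}) (hy : y ∈ Finset.Icc 1 n \ {u, w})
    (hvz : v ≠ z) (hvy : v ≠ y) (hzy : z ≠ y) (hvs : v ≠ s) (hzs : z ≠ s) (hys : y ≠ s)
    (ht : ∀ i j, (i = v ∨ i = y) → (j = v ∨ j = z) →
      relabel id u w i j t₁ ≠ relabel id u w i j t₂) :
    VanishesOnFourCycle g u w v := by
  have hf : UsesLabels (Finset.Icc 1 n \ {u, w}) K (id : ℕ → ℕ) := by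
    rw [usesLabels_iff, Finset.image_id, Finset.card_sdiff_of_subset (by simp [Finset.insert_subset_iff,
      Finset.mem_Icc.1 hu, Finset.mem_Icc.1 hw]), Finset.card_pair huw, Nat.card_Icc]
    omega
  refine hg.vanishesOnFourCycle hu hw huw hf hv hz hy hvz hvy hzy
    (fun x _ hx => hx.ge) fun i j hi hj => .inr (.inr ⟨ht i j hi hj, fun x _ hx => ?_⟩)
  have hs' : relabel id u w i j s = s := by simp [relabel, hus.symm, hws.symm]
  rw [hs'] at hx
  simp only [id] at hi hj
  unfold relabel at hx
  split_ifs at hx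
  · omega
  · omega
  · exact hx.ge

theorem ConstOnFace.vanishes_of_eq_sub_two (hg : ConstOnFace n K s t₁ t₂ g c) (hn : 6 ≤ n)
    (hK : K + 2 = n) (ht₁ : t₁ ∈ Finset.Icc 1 n)
    (ht₂ : t₂ ∈ Finset.Icc 1 n) (h₁ : t₁ < t₂) (h₂ : t₂ < s)
    (hu : u ∈ Finset.Icc 1 n) (hw : w ∈ Finset.Icc 1 n) (huw : u ≠ w) (hus : u ≠ s) (hws : w ≠ s)
    (hv : v ∈ Finset.Icc 1 n) (hvu : v ≠ u) (hvw : v ≠ w) (hvs : v ≠ s)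
    (h₁₂ : u = t₁ ∨ w = t₁ → u ≠ t₂ ∧ w ≠ t₂ ∧ v ≠ t₂)
    (h₂₁ : u = t₂ ∨ w = t₂ → u ≠ t₁ ∧ w ≠ t₁ ∧ v ≠ t₁) :
    VanishesOnFourCycle g u w v := by
  have hmem : ∀ {x a b : ℕ}, x ∈ Finset.Icc 1 n → x ≠ a → x ≠ b → x ∈ Finset.Icc 1 n \ {a, b} := by
    intro x a b hx ha hb
    simp [Finset.mem_Icc.1 hx, ha, hb]
  have key : ∀ {u w t t' : ℕ}, (t = t₁ ∧ t' = t₂ ∨ t = t₂ ∧ t' = t₁) → u = t → t' ≠ w → v ≠ t' →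
      u ∈ Finset.Icc 1 n → w ∈ Finset.Icc 1 n → u ≠ w → u ≠ s → w ≠ s → v ≠ u → v ≠ w →
      VanishesOnFourCycle g u w v := by
    intro u w t t' htt hut ht'w hvt' hu hw huw hus hws hvu hvw
    have ht'n : t' ∈ Finset.Icc 1 n := by rcases htt with ⟨_, rfl⟩ | ⟨_, rfl⟩ <;> assumption
    obtain ⟨y, hy, hyS⟩ := exists_mem_Icc_notMem (n := n) (S := {u, w, v, s, t'})
      (Finset.card_le_five.trans_lt (by omega))
    simp only [Finset.mem_insert, Finset.mem_singleton, not_or] at hyS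
    obtain ⟨hyu, hyw, hyv, hys, hyt⟩ := hyS
    refine hg.vanishes_of_singletons hK hu hw huw hus hws (hmem hv hvu hvw)
      (hmem ht'n (by omega) ht'w) (hmem hy hyu hyw) hvt' (Ne.symm hyv) (Ne.symm hyt) hvs
      (by omega) hys fun i j hi _ => ?_
    have hi' : relabel id u w i j t = i := by simp [relabel, hut]
    have ht' : relabel id u w i j t' = t' := by
      have : t' ≠ u := by omega
      simp [relabel, this, ht'w]
    have hit : i ≠ t' := by omega
    rcases htt with ⟨rfl, rfl⟩ | ⟨rfl, rfl⟩
    · rw [hi', ht']; exact hit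
    · rw [hi', ht']; exact hit.symm
  by_cases hut₁ : u = t₁
  · have := h₁₂ (.inl hut₁)
    exact key (.inl ⟨rfl, rfl⟩) hut₁ this.2.1.symm this.2.2 hu hw huw hus hws hvu hvw
  by_cases hut₂ : u = t₂
  · have := h₂₁ (.inl hut₂)
    exact key (.inr ⟨rfl, rfl⟩) hut₂ this.2.1.symm this.2.2 hu hw huw hus hws hvu hvw
  by_cases hwt₁ : w = t₁
  · have := h₁₂ (.inr hwt₁)
    exact (key (.inl ⟨rfl, rfl⟩) hwt₁ this.1.symm this.2.2 hw hu huw.symm hws hus hvw hvu).symm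
  by_cases hwt₂ : w = t₂
  · have := h₂₁ (.inr hwt₂)
    exact (key (.inr ⟨rfl, rfl⟩) hwt₂ this.1.symm this.2.2 hw hu huw.symm hws hus hvw hvu).symm
  obtain ⟨z, hz, hzS⟩ := exists_mem_Icc_notMem (n := n) (S := {u, w, v, s})
    (Finset.card_le_four.trans_lt (by omega))
  obtain ⟨y, hy, hyS⟩ := exists_mem_Icc_notMem (n := n) (S := {u, w, v, s, z})
    (Finset.card_le_five.trans_lt (by omega))
  simp only [Finset.mem_insert, Finset.mem_singleton, not_or] at hzS hyS
  obtain ⟨hzu, hzw, hzv, hzs⟩ := hzS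
  obtain ⟨hyu, hyw, hyv, hys, hyz⟩ := hyS
  refine hg.vanishes_of_singletons hK hu hw huw hus hws (hmem hv hvu hvw) (hmem hz hzu hzw)
    (hmem hy hyu hyw) (Ne.symm hzv) (Ne.symm hyv) (Ne.symm hyz) hvs hzs hys fun i j _ _ => ?_
  simp [relabel, Ne.symm hut₁, Ne.symm hut₂, Ne.symm hwt₁, Ne.symm hwt₂, h₁.ne]

end Singletons

section Coefficients

variable {n K s t₁ t₂ u w v : ℕ} {g : GPoint →ₗ[ℝ] ℝ} {c : ℝ}

/-- Up to antisymmetric and diagonal edge coordinates, `g` only involves the coordinates of the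
strengthened triangle inequality. -/
def SupportedOnTriangle (n s t₁ t₂ : ℕ) (g : GPoint →ₗ[ℝ] ℝ) : Prop :=
  (∀ p ∈ Finset.Icc 1 n, ∀ q ∈ Finset.Icc 1 n, p < q → ¬ (p = t₁ ∧ q = t₂) →
    ¬ (q = s ∧ (p = t₁ ∨ p = t₂)) → g (edgeVec p q) + g (edgeVec q p) = 0) ∧
  ∀ v ∈ Finset.Icc 1 n, v ≠ s → g (repVec v) = 0

theorem repVec_eq_zero (hv : v ≤ 3) : repVec v = 0 := if_neg (by omega)

theorem VanishesOnFourCycle.edge_eq_zero (h : VanishesOnFourCycle g u w v) (hv : v ≤ 3) :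
    g (edgeVec u w) + g (edgeVec w u) = 0 := by
  unfold VanishesOnFourCycle at h
  split_ifs at h with huw
  · rw [repVec_eq_zero hv, repVec_eq_zero (by omega : max u w ≤ 3)] at h
    linarith
  · linarith

theorem ConstOnFace.apex_edge_eq_zero (hg : ConstOnFace n K s t₁ t₂ g c) (hn : 5 ≤ n)
    (hK₁ : 3 ≤ K) (hK₂ : K ≤ n - 2) (hs : s ∈ Finset.Icc 1 n) (ht₁ : t₁ ∈ Finset.Icc 1 n)
    (ht₂ : t₂ ∈ Finset.Icc 1 n) (h₁ : t₁ < t₂) (h₂ : t₂ < s)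
    (hu : u ∈ Finset.Icc 1 n) (hus : u ≠ s) (hut₁ : u ≠ t₁) (hut₂ : u ≠ t₂) :
    g (edgeVec u s) + g (edgeVec s u) = 0 := by
  have h := hg.vanishes_apex hn hK₁ hK₂ hs ht₁ ht₂ h₁ h₂ hu hus hut₁ hut₂
  unfold VanishesOnFourCycle at h
  rw [if_neg (by omega)] at h
  linarith

theorem ConstOnFace.supportedOnTriangle_of_six_le (hg : ConstOnFace n K s t₁ t₂ g c) (hn : 6 ≤ n)
    (hK₁ : 3 ≤ K) (hK₂ : K ≤ n - 2) (hs : s ∈ Finset.Icc 1 n) (ht₁ : t₁ ∈ Finset.Icc 1 n)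
    (ht₂ : t₂ ∈ Finset.Icc 1 n) (h₁ : t₁ < t₂) (h₂ : t₂ < s) (h₃ : 4 ≤ s)
    (h : 4 ≤ t₂ ∨ K ≤ n - 3) : SupportedOnTriangle n s t₁ t₂ g := by
  have hcycle : ∀ u w v, u ∈ Finset.Icc 1 n → w ∈ Finset.Icc 1 n → v ∈ Finset.Icc 1 n → u < w →
      u ≠ s → w ≠ s → v ≠ u → v ≠ w → v ≠ s → ¬ (u = t₁ ∧ w = t₂) →
      (4 ≤ t₂ → (u = t₁ ∨ w = t₁ → v ≠ t₂) ∧ (u = t₂ ∨ w = t₂ → v ≠ t₁)) →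
      VanishesOnFourCycle g u w v := by
    intro u w v hu hw hv huw hus hws hvu hvw hvs hne hcond
    by_cases hK : K ≤ n - 3
    · by_cases hut : u ≠ t₁ ∧ w ≠ t₁
      · exact hg.vanishes_of_le_sub_three (by omega) hK₁ hK hs hu hw huw.ne hus hws (.inl rfl) ht₁
          (by omega) hut.1.symm hut.2.symm hv hvu hvw hvs
      · exact hg.vanishes_of_le_sub_three (by omega) hK₁ hK hs hu hw huw.ne hus hws (.inr rfl) ht₂
          (by omega) (by omega) (by omega) hv hvu hvw hvs
    · exact hg.vanishes_of_eq_sub_two hn (by omega) ht₁ ht₂ h₁ h₂ hu hw huw.ne hus hws hv hvu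
        hvw hvs (by omega) (by omega)
  have hIcc : ∀ x, 1 ≤ x → x ≤ 3 → x ∈ Finset.Icc 1 n := fun x h1 h2 =>
    Finset.mem_Icc.2 ⟨h1, by omega⟩
  have hedge : ∀ p ∈ Finset.Icc 1 n, ∀ q ∈ Finset.Icc 1 n, p < q → ¬ (p = t₁ ∧ q = t₂) →
      ¬ (q = s ∧ (p = t₁ ∨ p = t₂)) → g (edgeVec p q) + g (edgeVec q p) = 0 := by
    intro p hp q hq hpq hne hnes
    by_cases hqs : q = s
    · subst hqs
      exact hg.apex_edge_eq_zero (by omega) hK₁ hK₂ hs ht₁ ht₂ h₁ h₂ hp hpq.ne (by omega) (by omega)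
    by_cases hps : p = s
    · subst hps
      rw [add_comm]
      exact hg.apex_edge_eq_zero (by omega) hK₁ hK₂ hs ht₁ ht₂ h₁ h₂ hq hqs (by omega) (by omega)
    obtain ⟨v, hv1, hv3, hvp, hvq, hv⟩ : ∃ v, 1 ≤ v ∧ v ≤ 3 ∧ v ≠ p ∧ v ≠ q ∧
        (4 ≤ t₂ → p = t₂ ∨ q = t₂ → v ≠ t₁) := by
      by_contra! hcon
      have hv1 := hcon 1 (by norm_num) (by norm_num)
      have hv2 := hcon 2 (by norm_num) (by norm_num)
      have hv3 := hcon 3 (by norm_num) (by norm_num)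
      omega
    exact (hcycle p q v hp hq (hIcc v hv1 hv3) hpq hps hqs hvp hvq (by omega) hne
      (by omega)).edge_eq_zero hv3
  refine ⟨hedge, fun v hv hvs => ?_⟩
  obtain hv3 | hv4 := le_or_gt v 3
  · rw [repVec_eq_zero hv3, map_zero]
  obtain ⟨p, q, hp, hpq, hq, hpt, hqt⟩ : ∃ p q, 1 ≤ p ∧ p < q ∧ q ≤ 3 ∧ p ≠ t₁ ∧ q ≠ t₁ := by
    obtain h | h | h : t₁ = 1 ∨ t₁ = 2 ∨ (t₁ ≠ 1 ∧ t₁ ≠ 2) := by omega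
    · exact ⟨2, 3, by omega⟩
    · exact ⟨1, 3, by omega⟩
    · exact ⟨1, 2, by omega⟩
  have hp' := hIcc p hp (by omega)
  have hq' := hIcc q (by omega) hq
  have hpq0 := hedge p hp' q hq' hpq (by omega) (by omega)
  have hcyc := hcycle p q v hp' hq' hv hpq (by omega) (by omega) (by omega) (by omega) hvs
    (by omega) (by omega)
  unfold VanishesOnFourCycle at hcyc
  rw [if_pos (by omega), hpq0, repVec_eq_zero (v := max p q) (by omega), map_zero] at hcyc
  linarith

end Coefficients

section FiveVertices

variable {t u w : ℕ} {g : GPoint →ₗ[ℝ] ℝ} {c : ℝ}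

theorem ConstOnFace.eq_of_labels (hg : ConstOnFace 5 3 5 t 4 g c)
    (hV : Finset.Icc 1 5 = {t, u, w, 4, 5}) (htu : t ≠ u) (htw : t ≠ w) (huw : u ≠ w)
    (ht : t ≤ 3) (hu : u ≤ 3) (hw : w ≤ 3) (a b d x y : Fin 3)
    (himage : ({a, b, d, x, y} : Finset (Fin 3)).card = 3)
    (hface : y = a ∨ y = x ∨ (a ≠ x ∧ a ≠ y ∧ b ≠ y ∧ d ≠ y ∧ x ≠ y)) :
    g (edgeVec t t) + g (edgeVec u u) + g (edgeVec w w) + g (edgeVec 4 4) + g (edgeVec 5 5) +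
      (if a = b then g (edgeVec t u) + g (edgeVec u t) else 0) +
      (if a = d then g (edgeVec t w) + g (edgeVec w t) else 0) +
      (if b = d then g (edgeVec u w) + g (edgeVec w u) else 0) +
      (if a = x then g (edgeVec t 4) + g (edgeVec 4 t) else 0) +
      (if b = x then g (edgeVec u 4) + g (edgeVec 4 u) else 0) +
      (if d = x then g (edgeVec w 4) + g (edgeVec 4 w) else 0) +
      (if a = y then g (edgeVec t 5) + g (edgeVec 5 t) else 0) +
      (if b = y then g (edgeVec u 5) + g (edgeVec 5 u) else 0) +
      (if d = y then g (edgeVec w 5) + g (edgeVec 5 w) else 0) +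
      (if x = y then g (edgeVec 4 5) + g (edgeVec 5 4) else 0) +
      (if a ≠ x ∧ b ≠ x ∧ d ≠ x then g (repVec 4) else 0) +
      (if a ≠ y ∧ b ≠ y ∧ d ≠ y ∧ x ≠ y then g (repVec 5) else 0) = c := by
  classical
  obtain ⟨f, hfa, hfb, hfd, hfx, hfy⟩ : ∃ f : ℕ → Fin 3, f t = a ∧ f u = b ∧ f w = d ∧ f 4 = x ∧
      f 5 = y := by
    refine ⟨fun v => if v = t then a else if v = u then b else if v = w then d else
      if v = 4 then x else y, ?_⟩
    have h1 : 4 ≠ t := by omega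
    have h2 : 4 ≠ u := by omega
    have h3 : 4 ≠ w := by omega
    have h4 : 5 ≠ t := by omega
    have h5 : 5 ≠ u := by omega
    have h6 : 5 ≠ w := by omega
    simp [htu.symm, htw.symm, huw.symm, h1, h2, h3, h4, h5, h6]
  have hrep₄ : IsRep 5 f 4 ↔ a ≠ x ∧ b ≠ x ∧ d ≠ x := by
    unfold IsRep
    rw [hV]
    simp only [Finset.forall_mem_insert, Finset.mem_singleton, forall_eq, hfa, hfb, hfd, hfx, hfy]
    have : ¬ 4 ≤ t ∧ ¬ 4 ≤ u ∧ ¬ 4 ≤ w := by omega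
    simp [this]
  have hrep₅ : IsRep 5 f 5 ↔ a ≠ y ∧ b ≠ y ∧ d ≠ y ∧ x ≠ y := by
    unfold IsRep
    rw [hV]
    simp only [Finset.forall_mem_insert, Finset.mem_singleton, forall_eq, hfa, hfb, hfd, hfx, hfy]
    have : ¬ 5 ≤ t ∧ ¬ 5 ≤ u ∧ ¬ 5 ≤ w := by omega
    simp [this]
  have hf : UsesLabels (Finset.Icc 1 5) 3 f := by
    rw [usesLabels_iff, hV]
    simpa [Finset.image_insert, hfa, hfb, hfd, hfx, hfy] using himage
  have hfface : OnFace 5 5 t 4 f := by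
    unfold OnFace
    rw [hrep₅, hfa, hfx, hfy]
    exact hface
  have hsum : ∀ F : ℕ → ℝ, ∑ v ∈ Finset.Icc 1 5, F v = F t + F u + F w + F 4 + F 5 := by
    intro F
    have h1 : 4 ≠ t := by omega
    have h2 : 4 ≠ u := by omega
    have h3 : 4 ≠ w := by omega
    have h4 : 5 ≠ t := by omega
    have h5 : 5 ≠ u := by omega
    have h6 : 5 ≠ w := by omega
    rw [hV, Finset.sum_insert, Finset.sum_insert, Finset.sum_insert, Finset.sum_insert,
      Finset.sum_singleton]
    · ring
    all_goals simp [htu, htw, huw, h1.symm, h2.symm, h3.symm, h4.symm, h5.symm, h6.symm]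
  have h := hg _ f hf hfface
  rw [map_labelVec] at h
  simp only [hsum, hfa, hfb, hfd, hfx, hfy, hrep₄, hrep₅, repVec_eq_zero ht, repVec_eq_zero hu,
    repVec_eq_zero hw, map_zero, ite_self, if_true] at h
  have hadd : ∀ (i j : Fin 3) (p q : ℝ), (if i = j then p + q else 0) =
      (if i = j then p else 0) + (if j = i then q else 0) := by
    intro i j p q
    by_cases hij : i = j
    · simp [hij]
    · simp [hij, Ne.symm hij]
  simp only [hadd]
  linarith

theorem ConstOnFace.supportedOnTriangle_of_five (hg : ConstOnFace 5 3 5 t 4 g c)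
    (ht : 1 ≤ t) (ht' : t ≤ 3) : SupportedOnTriangle 5 5 t 4 g := by
  obtain ⟨u, w, hu1, huw, hw3, hut, hwt⟩ : ∃ u w, 1 ≤ u ∧ u < w ∧ w ≤ 3 ∧ u ≠ t ∧ w ≠ t := by
    obtain rfl | rfl | rfl : t = 1 ∨ t = 2 ∨ t = 3 := by omega
    · exact ⟨2, 3, by omega⟩
    · exact ⟨1, 3, by omega⟩
    · exact ⟨1, 2, by omega⟩
  have hV : Finset.Icc 1 5 = {t, u, w, 4, 5} := by
    ext v
    simp only [Finset.mem_Icc, Finset.mem_insert, Finset.mem_singleton]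
    omega
  have hu5 := hg.apex_edge_eq_zero (u := u) (by norm_num) (by norm_num) (by norm_num) (by simp)
    (Finset.mem_Icc.2 ⟨ht, by omega⟩) (by simp) (by omega) (by omega)
    (Finset.mem_Icc.2 ⟨by omega, by omega⟩) (by omega) hut (by omega)
  have hw5 := hg.apex_edge_eq_zero (u := w) (by norm_num) (by norm_num) (by norm_num) (by simp)
    (Finset.mem_Icc.2 ⟨ht, by omega⟩) (by simp) (by omega) (by omega)
    (Finset.mem_Icc.2 ⟨by omega, by omega⟩) (by omega) hwt (by omega)
  have key := hg.eq_of_labels hV hut.symm hwt.symm huw.ne ht' (by omega) hw3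
  have e₁ := key 0 1 1 2 0 (by decide) (by decide)
  have e₂ := key 0 0 1 2 0 (by decide) (by decide)
  have e₃ := key 0 1 0 2 0 (by decide) (by decide)
  have e₄ := key 0 1 2 1 0 (by decide) (by decide)
  have e₅ := key 0 1 2 2 0 (by decide) (by decide)
  have e₆ := key 0 1 1 2 2 (by decide) (by decide)
  have e₇ := key 0 2 1 2 2 (by decide) (by decide)
  have e₈ := key 0 1 2 2 2 (by decide) (by decide)
  have e₉ := key 0 0 1 2 2 (by decide) (by decide)
  have e₁₀ := key 0 1 0 2 2 (by decide) (by decide)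
  have e₁₁ := key 0 1 2 0 0 (by decide) (by decide)
  have e₁₂ := key 0 0 1 1 2 (by decide) (by decide)
  have e₁₃ := key 0 1 0 1 2 (by decide) (by decide)
  have e₁₄ := key 0 0 0 1 2 (by decide) (by decide)
  have e₁₅ := key 0 1 1 1 2 (by decide) (by decide)
  simp [hu5, hw5] at e₁ e₂ e₃ e₄ e₅ e₆ e₇ e₈ e₉ e₁₀ e₁₁ e₁₂ e₁₃ e₁₄ e₁₅
  have huw0 : g (edgeVec u w) + g (edgeVec w u) = 0 := by linarith
  have htu0 : g (edgeVec t u) + g (edgeVec u t) = 0 := by linarith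
  have htw0 : g (edgeVec t w) + g (edgeVec w t) = 0 := by linarith
  have hu40 : g (edgeVec u 4) + g (edgeVec 4 u) = 0 := by linarith
  have hw40 : g (edgeVec w 4) + g (edgeVec 4 w) = 0 := by linarith
  have hr40 : g (repVec 4) = 0 := by linarith
  refine ⟨fun p hp q hq hpq h1 h2 => ?_, fun v hv hv5 => ?_⟩
  · rw [hV] at hp hq
    simp only [Finset.mem_insert, Finset.mem_singleton] at hp hq
    rcases hp with rfl | rfl | rfl | rfl | rfl <;> rcases hq with rfl | rfl | rfl | rfl | rfl <;>
      first | (exfalso; omega) | linarith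
  · obtain h | rfl : v ≤ 3 ∨ v = 4 := by
      have := Finset.mem_Icc.1 hv
      omega
    · rw [repVec_eq_zero h, map_zero]
    · exact hr40

end FiveVertices

section Facet

variable {n K s t₁ t₂ : ℕ} {L : Type} {g : GPoint →ₗ[ℝ] ℝ} {c : ℝ}

theorem exists_triangle_labelling (hK₁ : 3 ≤ K) (hK₂ : K ≤ n - 2) (hs : s ∈ Finset.Icc 1 n)
    (ht₁ : t₁ ∈ Finset.Icc 1 n) (ht₂ : t₂ ∈ Finset.Icc 1 n) (h₁ : t₁ < t₂) (h₂ : t₂ < s)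
    (i j k m c₀ : ℕ) (hijk : ({i, j, k} : Finset ℕ) = Finset.range m) (hm : m ≤ 3) (hc₀ : c₀ < m) :
    ∃ f : ℕ → ℕ ⊕ ℕ, UsesLabels (Finset.Icc 1 n) K f ∧ f t₁ = .inl i ∧ f t₂ = .inl j ∧
      f s = .inl k ∧ (k ≠ i → k ≠ j → k ≠ c₀ → IsRep n f s) := by
  have hD : ({t₁, t₂, s} : Finset ℕ) ⊆ Finset.Icc 1 n := by
    simp only [Finset.insert_subset_iff, Finset.singleton_subset_iff]
    exact ⟨ht₁, ht₂, hs⟩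
  have hcard : ({t₁, t₂, s} : Finset ℕ).card ≤ 3 := Finset.card_le_three
  have h₂₁ : s ≠ t₁ := by omega
  obtain ⟨f, hf, hfD, hfN⟩ := exists_extension (K := K) (c₀ := c₀) hD
    (f₀ := fun x => if x = t₁ then i else if x = t₂ then j else k)
    (k := m) (by simpa [Finset.image_insert, h₁.ne', h₂.ne', h₂₁] using hijk) hc₀ (by omega)
    (by rw [Nat.card_Icc]; omega)
  have hf₁ : f t₁ = .inl i := by simp [hfD]
  have hf₂ : f t₂ = .inl j := by simp [hfD, h₁.ne']
  have hfs : f s = .inl k := by simp [hfD, h₂.ne', h₂₁]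
  refine ⟨f, hf, hf₁, hf₂, hfs, fun hki hkj hkc x hx hxs => ?_⟩
  rw [hfs] at hxs
  by_cases hxD : x ∈ ({t₁, t₂, s} : Finset ℕ)
  · simp only [Finset.mem_insert, Finset.mem_singleton] at hxD
    rcases hxD with rfl | rfl | rfl
    · rw [hf₁] at hxs
      exact absurd (Sum.inl_injective hxs).symm hki
    · rw [hf₂] at hxs
      exact absurd (Sum.inl_injective hxs).symm hkj
    · exact le_rfl
  · rcases hfN x hxD with h | h
    · rw [h] at hxs
      exact absurd (Sum.inl_injective hxs).symm hkc
    · rw [h] at hxs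
      exact absurd hxs (by simp)

open Classical in
theorem SupportedOnTriangle.map_labelVec (hg : SupportedOnTriangle n s t₁ t₂ g)
    (hs : s ∈ Finset.Icc 1 n) (ht₁ : t₁ ∈ Finset.Icc 1 n) (ht₂ : t₂ ∈ Finset.Icc 1 n)
    (h₁ : t₁ < t₂) (h₂ : t₂ < s) (h₃ : 4 ≤ s) (f : ℕ → L) :
    g (labelVec n f) = ∑ p ∈ Finset.Icc 1 n, g (edgeVec p p) +
      (if f s = f t₁ then g (edgeVec t₁ s) + g (edgeVec s t₁) else 0) +
      (if f s = f t₂ then g (edgeVec t₂ s) + g (edgeVec s t₂) else 0) +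
      (if f t₁ = f t₂ then g (edgeVec t₁ t₂) + g (edgeVec t₂ t₁) else 0) +
      (if IsRep n f s then g (repVec s) else 0) := by
  set A := g (edgeVec t₁ s) + g (edgeVec s t₁) with hA
  set B := g (edgeVec t₂ s) + g (edgeVec s t₂) with hB
  set C := g (edgeVec t₁ t₂) + g (edgeVec t₂ t₁) with hC
  set R := g (repVec s) with hR
  set h : GPoint →ₗ[ℝ] ℝ := g - (A • edgeL s t₁ + B • edgeL s t₂ + C • edgeL t₁ t₂ + R • repL s)
    with hh
  have hrepfst : ∀ v p, (repVec v).1 p = 0 := by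
    intro v p
    unfold repVec
    split_ifs <;> rfl
  have hhedge : ∀ p q, h (edgeVec p q) = g (edgeVec p q) -
      ((if s = p ∧ t₁ = q then A else 0) + (if s = p ∧ t₂ = q then B else 0) +
        (if t₁ = p ∧ t₂ = q then C else 0)) := by
    intro p q
    simp [hh, edgeVec, Pi.single_apply]
  have hhrep : ∀ v, h (repVec v) = g (repVec v) - if s = v then R else 0 := by
    intro v
    simp [hh, hrepfst, repVec_snd, h₃]
  have hedge : ∀ p ∈ Finset.Icc 1 n, ∀ q ∈ Finset.Icc 1 n, p < q →
      h (edgeVec p q) + h (edgeVec q p) = 0 := by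
    intro p hp q hq hpq
    rw [hhedge, hhedge]
    by_cases hpq₁ : p = t₁ ∧ q = t₂
    · obtain ⟨rfl, rfl⟩ := hpq₁
      have : s ≠ p := by omega
      simp [this, h₁.ne, h₁.ne', h₂.ne']
      linarith
    by_cases hqs : q = s
    · subst hqs
      have hqt₁ : t₁ ≠ q := by omega
      by_cases hpt₁ : p = t₁
      · subst hpt₁
        simp [hpq.ne, hpq.ne', h₁.ne', h₂.ne]
        linarith
      by_cases hpt₂ : p = t₂
      · subst hpt₂
        simp [hpq.ne, hpq.ne', h₁.ne, hqt₁]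
        linarith
      have h0 := hg.1 p hp q hq hpq hpq₁ (by tauto)
      simp [hpq.ne', Ne.symm hpt₁, Ne.symm hpt₂, hqt₁, h₂.ne]
      linarith
    have h0 := hg.1 p hp q hq hpq hpq₁ (by tauto)
    have e1 : ¬ (s = p ∧ t₁ = q) := by omega
    have e2 : ¬ (s = p ∧ t₂ = q) := by omega
    have e3 : ¬ (t₁ = p ∧ t₂ = q) := by omega
    have e4 : ¬ (t₁ = q ∧ t₂ = p) := by omega
    rw [if_neg e1, if_neg e2, if_neg e3, if_neg e4, if_neg (fun h => hqs h.1.symm),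
      if_neg (fun h => hqs h.1.symm)]
    linarith
  have hval := map_labelVec_of_vanishing (h := h) (n := n) ?_ ?_ f
  · have hdiag : ∑ p ∈ Finset.Icc 1 n, h (edgeVec p p) =
        ∑ p ∈ Finset.Icc 1 n, g (edgeVec p p) := by
      refine Finset.sum_congr rfl fun p _ => ?_
      have e1 : ¬ (s = p ∧ t₁ = p) := by omega
      have e2 : ¬ (s = p ∧ t₂ = p) := by omega
      have e3 : ¬ (t₁ = p ∧ t₂ = p) := by omega
      rw [hhedge, if_neg e1, if_neg e2, if_neg e3]
      ring
    rw [hdiag] at hval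
    simp only [hh, LinearMap.sub_apply, LinearMap.add_apply, LinearMap.smul_apply, edgeL_apply,
      repL_apply, smul_eq_mul, labelVec_fst hs ht₁, labelVec_fst hs ht₂, labelVec_fst ht₁ ht₂,
      labelVec_snd, h₃, hs, true_and, mul_ite, mul_one, mul_zero] at hval
    linarith
  · intro p hp q hq hpq
    rcases hpq.lt_or_gt with hlt | hlt
    · exact hedge p hp q hq hlt
    · rw [add_comm]
      exact hedge q hq p hp hlt
  · intro v hv
    rw [hhrep]
    by_cases hvs : s = v
    · rw [if_pos hvs, hR, hvs, sub_self]
    · rw [if_neg hvs, hg.2 v hv (Ne.symm hvs), sub_zero]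

theorem ConstOnFace.eq_mul_triangle (hg : ConstOnFace n K s t₁ t₂ g c)
    (hsupp : SupportedOnTriangle n s t₁ t₂ g) (hK₁ : 3 ≤ K) (hK₂ : K ≤ n - 2)
    (hs : s ∈ Finset.Icc 1 n) (ht₁ : t₁ ∈ Finset.Icc 1 n) (ht₂ : t₂ ∈ Finset.Icc 1 n)
    (h₁ : t₁ < t₂) (h₂ : t₂ < s) (h₃ : 4 ≤ s) :
    ∃ l : ℝ, ∀ (L : Type) (f : ℕ → L),
      g (labelVec n f) - c = l * (triangle s t₁ t₂ (labelVec n f) - 1) := by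
  classical
  have hval := fun {L : Type} (f : ℕ → L) => hsupp.map_labelVec hs ht₁ ht₂ h₁ h₂ h₃ f
  obtain ⟨f₁, hf₁, f₁t₁, f₁t₂, f₁s, -⟩ := exists_triangle_labelling hK₁ hK₂ hs ht₁ ht₂ h₁ h₂
    0 1 0 2 1 (by decide) (by norm_num) (by norm_num)
  obtain ⟨f₂, hf₂, f₂t₁, f₂t₂, f₂s, -⟩ := exists_triangle_labelling hK₁ hK₂ hs ht₁ ht₂ h₁ h₂
    1 0 0 2 1 (by decide) (by norm_num) (by norm_num)
  obtain ⟨f₃, hf₃, f₃t₁, f₃t₂, f₃s, -⟩ := exists_triangle_labelling hK₁ hK₂ hs ht₁ ht₂ h₁ h₂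
    0 0 0 1 0 (by decide) (by norm_num) (by norm_num)
  obtain ⟨f₄, hf₄, f₄t₁, f₄t₂, f₄s, f₄r⟩ := exists_triangle_labelling hK₁ hK₂ hs ht₁ ht₂ h₁ h₂
    0 1 2 3 1 (by decide) (by norm_num) (by norm_num)
  have hnot₁ : ∀ {f : ℕ → ℕ ⊕ ℕ}, f s = f t₁ → ¬ IsRep n f s := fun h hr =>
    absurd (hr t₁ ht₁ h.symm) (by omega)
  have hnot₂ : ∀ {f : ℕ → ℕ ⊕ ℕ}, f s = f t₂ → ¬ IsRep n f s := fun h hr =>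
    absurd (hr t₂ ht₂ h.symm) (by omega)
  have f₁n := hnot₁ (f₁s.trans f₁t₁.symm)
  have f₂n := hnot₂ (f₂s.trans f₂t₂.symm)
  have f₃n := hnot₁ (f₃s.trans f₃t₁.symm)
  have f₄r' := f₄r (by norm_num) (by norm_num) (by norm_num)
  have e₁ := hval f₁
  have e₂ := hval f₂
  have e₃ := hval f₃
  have e₄ := hval f₄
  rw [hg _ f₁ hf₁ (.inl (f₁s.trans f₁t₁.symm))] at e₁
  rw [hg _ f₂ hf₂ (.inr (.inl (f₂s.trans f₂t₂.symm)))] at e₂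
  rw [hg _ f₃ hf₃ (.inl (f₃s.trans f₃t₁.symm))] at e₃
  rw [hg _ f₄ hf₄ (.inr (.inr ⟨by simp [f₄t₁, f₄t₂], f₄r'⟩))] at e₄
  simp [f₁t₁, f₁t₂, f₁s, f₁n] at e₁
  simp [f₂t₁, f₂t₂, f₂s, f₂n] at e₂
  simp [f₃t₁, f₃t₂, f₃s, f₃n] at e₃
  simp [f₄t₁, f₄t₂, f₄s, f₄r'] at e₄
  refine ⟨g (repVec s), fun L f => ?_⟩
  have hA : g (edgeVec t₁ s) + g (edgeVec s t₁) = g (repVec s) := by linarith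
  have hB : g (edgeVec t₂ s) + g (edgeVec s t₂) = g (repVec s) := by linarith
  have hC : g (edgeVec t₁ t₂) + g (edgeVec t₂ t₁) = - g (repVec s) := by linarith
  rw [hval f, hA, hB, hC, e₄, triangle_apply, labelVec_fst hs ht₁, labelVec_fst hs ht₂,
    labelVec_fst ht₁ ht₂, labelVec_snd]
  simp only [h₃, hs, true_and]
  split_ifs <;> ring

theorem adim_face_add_one_of_supported (hK₁ : 3 ≤ K) (hK₂ : K ≤ n - 2)
    (hs : s ∈ Finset.Icc 1 n) (ht₁ : t₁ ∈ Finset.Icc 1 n) (ht₂ : t₂ ∈ Finset.Icc 1 n)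
    (h₁ : t₁ < t₂) (h₂ : t₂ < s) (h₃ : 4 ≤ s)
    (hsupp : ∀ (g : GPoint →ₗ[ℝ] ℝ) (c : ℝ), ConstOnFace n K s t₁ t₂ g c →
      SupportedOnTriangle n s t₁ t₂ g) :
    adim {x | x ∈ PolyP n K ∧ triangle s t₁ t₂ x = 1} + 1 = adim (PolyP n K) := by
  have htri := fun {L : Type} (f : ℕ → L) =>
    triangle_labelVec_le_and_eq_iff hs ht₁ ht₂ h₁ h₂ h₃ f
  obtain ⟨f₁, hf₁, f₁t₁, f₁t₂, f₁s, -⟩ := exists_triangle_labelling hK₁ hK₂ hs ht₁ ht₂ h₁ h₂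
    0 1 0 2 1 (by decide) (by norm_num) (by norm_num)
  obtain ⟨f₂, hf₂, f₂t₁, f₂t₂, f₂s, -⟩ := exists_triangle_labelling hK₁ hK₂ hs ht₁ ht₂ h₁ h₂
    0 0 1 2 0 (by decide) (by norm_num) (by norm_num)
  obtain ⟨π₁, hπ₁⟩ := exists_kPartition hf₁
  obtain ⟨π₂, hπ₂⟩ := exists_kPartition hf₂
  refine adim_face_add_one (finite_charVecs n K) (x₀ := charVec n K π₁) (y₀ := charVec n K π₂)
    ⟨π₁, rfl⟩ ?_ ⟨π₂, rfl⟩ ?_ fun g c hgc => ?_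
  · rw [hπ₁, (htri f₁).2]
    exact .inl (f₁s.trans f₁t₁.symm)
  · rw [hπ₂, Ne, (htri f₂).2]
    simp [OnFace, f₂t₁, f₂t₂, f₂s]
  · have hconst : ConstOnFace n K s t₁ t₂ g c := by
      intro L f hf hface
      obtain ⟨π, hπ⟩ := exists_kPartition hf
      rw [← hπ]
      exact hgc _ ⟨π, rfl⟩ (by rw [hπ]; exact (htri f).2.2 hface)
    obtain ⟨l, hl⟩ := hconst.eq_mul_triangle (hsupp g c hconst) hK₁ hK₂ hs ht₁ ht₂ h₁ h₂ h₃
    refine ⟨l, ?_⟩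
    rintro _ ⟨π, rfl⟩
    obtain ⟨f, -, hf⟩ := exists_labelling π
    rw [hf]
    exact hl _ f

theorem triangle_le_one (hs : s ∈ Finset.Icc 1 n) (ht₁ : t₁ ∈ Finset.Icc 1 n)
    (ht₂ : t₂ ∈ Finset.Icc 1 n) (h₁ : t₁ < t₂) (h₂ : t₂ < s) (h₃ : 4 ≤ s) {x : GPoint}
    (hx : x ∈ PolyP n K) : triangle s t₁ t₂ x ≤ 1 := by
  refine convexHull_min ?_ (convex_halfSpace_le (triangle s t₁ t₂).isLinear 1) hx
  rintro _ ⟨π, rfl⟩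
  obtain ⟨f, -, hf⟩ := exists_labelling π
  rw [hf]
  exact (triangle_labelVec_le_and_eq_iff hs ht₁ ht₂ h₁ h₂ h₃ f).1

end Facet

section NotFacet

variable {n K s t₁ t₂ : ℕ} {L : Type} {f : ℕ → L}

open Classical in
theorem UsesLabels.card_filter_isRep (hf : UsesLabels (Finset.Icc 1 n) K f) :
    ((Finset.Icc 1 n).filter (IsRep n f)).card = K := by
  rw [usesLabels_iff] at hf
  rw [← hf, ← Finset.card_image_of_injOn (f := f)]
  · congr 1
    refine (Finset.image_subset_image (Finset.filter_subset _ _)).antisymm fun l hl => ?_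
    obtain ⟨v, hv, rfl⟩ := Finset.mem_image.1 hl
    obtain ⟨m, hm, hmin⟩ := Finset.exists_min_image ((Finset.Icc 1 n).filter (f · = f v)) id
      ⟨v, Finset.mem_filter.2 ⟨hv, rfl⟩⟩
    rw [Finset.mem_filter] at hm
    refine Finset.mem_image.2 ⟨m, Finset.mem_filter.2 ⟨hm.1, fun x hx hxm => ?_⟩, hm.2⟩
    exact hmin x (Finset.mem_filter.2 ⟨hx, hxm.trans hm.2⟩)
  · intro v hv w hw hvw
    have hv := Finset.mem_filter.1 hv
    have hw := Finset.mem_filter.1 hw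
    exact le_antisymm (hv.2 w hw.1 hvw.symm) (hw.2 v hv.1 hvw)

/-- A functional which on vertices of `P_{n,K}` detects whether `1`, `2`, `3` lie in one
cluster. -/
noncomputable def initialTriangle (n : ℕ) : GPoint →ₗ[ℝ] ℝ :=
  edgeL 1 2 + edgeL 1 3 + edgeL 2 3 - ∑ v ∈ Finset.Icc 4 n, repL v

open Classical in
theorem UsesLabels.initialTriangle_labelVec (hf : UsesLabels (Finset.Icc 1 n) K f) (hn : 3 ≤ n) :
    initialTriangle n (labelVec n f) = 3 - K + if f 2 = f 1 ∧ f 3 = f 1 then 1 else 0 := by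
  have hcard : (∑ v ∈ Finset.Icc 1 n, if IsRep n f v then (1 : ℝ) else 0) = K := by
    rw [Finset.sum_boole, hf.card_filter_isRep]
  have hIcc : Finset.Icc 1 n = insert 1 (insert 2 (insert 3 (Finset.Icc 4 n))) := by
    ext v
    simp only [Finset.mem_Icc, Finset.mem_insert]
    omega
  have m1 : 1 ∈ Finset.Icc 1 n := Finset.mem_Icc.2 (by omega)
  have m2 : 2 ∈ Finset.Icc 1 n := Finset.mem_Icc.2 (by omega)
  have m3 : 3 ∈ Finset.Icc 1 n := Finset.mem_Icc.2 (by omega)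
  have hr₁ : IsRep n f 1 := fun x hx _ => (Finset.mem_Icc.1 hx).1
  have hr₂ : IsRep n f 2 ↔ f 2 ≠ f 1 := by
    refine ⟨fun h h21 => absurd (h 1 m1 h21.symm) (by norm_num), fun h x hx hx2 => ?_⟩
    have := (Finset.mem_Icc.1 hx).1
    by_contra hlt
    obtain rfl : x = 1 := by omega
    exact h hx2.symm
  have hr₃ : IsRep n f 3 ↔ f 3 ≠ f 1 ∧ f 3 ≠ f 2 := by
    refine ⟨fun h => ⟨fun h31 => absurd (h 1 m1 h31.symm) (by norm_num),
      fun h32 => absurd (h 2 m2 h32.symm) (by norm_num)⟩, fun h x hx hx3 => ?_⟩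
    have := (Finset.mem_Icc.1 hx).1
    by_contra hlt
    obtain rfl | rfl : x = 1 ∨ x = 2 := by omega
    · exact h.1 hx3.symm
    · exact h.2 hx3.symm
  have hsum : (∑ v ∈ Finset.Icc 4 n, (labelVec n f).2 v) =
      ∑ v ∈ Finset.Icc 4 n, if IsRep n f v then (1 : ℝ) else 0 := by
    refine Finset.sum_congr rfl fun v hv => ?_
    have hv := Finset.mem_Icc.1 hv
    have hv' : v ∈ Finset.Icc 1 n := Finset.mem_Icc.2 (by omega)
    rw [labelVec_snd]
    simp only [hv.1, hv', true_and]
  rw [hIcc, Finset.sum_insert (by simp), Finset.sum_insert (by simp),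
    Finset.sum_insert (by simp), ← hsum] at hcard
  have hval : initialTriangle n (labelVec n f) = (if f 1 = f 2 then 1 else 0) +
      (if f 1 = f 3 then 1 else 0) + (if f 2 = f 3 then 1 else 0) -
      ∑ v ∈ Finset.Icc 4 n, (labelVec n f).2 v := by
    simp only [initialTriangle, LinearMap.sub_apply, LinearMap.add_apply, LinearMap.sum_apply,
      edgeL_apply, repL_apply, labelVec_fst m1 m2, labelVec_fst m1 m3, labelVec_fst m2 m3]
  simp only [hr₁, hr₂, hr₃, if_true] at hcard
  rw [hval]
  by_cases h12 : f 1 = f 2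
  · by_cases h13 : f 1 = f 3
    · simp [← h12, ← h13] at hcard ⊢
      linarith
    · simp [← h12, h13, Ne.symm h13] at hcard ⊢
      linarith
  · by_cases h13 : f 1 = f 3
    · simp [← h13, h12, Ne.symm h12] at hcard ⊢
      linarith
    · by_cases h23 : f 2 = f 3
      · simp [← h23, h12, Ne.symm h12] at hcard ⊢
        linarith
      · simp [h12, h13, h23, Ne.symm h12, Ne.symm h13, Ne.symm h23] at hcard ⊢
        linarith

theorem UsesLabels.isRep_of_eq (hf : UsesLabels (Finset.Icc 1 n) (n - 2) f) (hn : 3 ≤ n)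
    (h : f 2 = f 1 ∧ f 3 = f 1) (hs : s ∈ Finset.Icc 1 n) (h₃ : 4 ≤ s) : IsRep n f s := by
  classical
  have hsub : (Finset.Icc 1 n).filter (IsRep n f) ⊆ Finset.Icc 1 n \ {2, 3} := by
    intro v hv
    rw [Finset.mem_filter] at hv
    have m1 : 1 ∈ Finset.Icc 1 n := Finset.mem_Icc.2 (by omega)
    rw [Finset.mem_sdiff, Finset.mem_insert, Finset.mem_singleton]
    refine ⟨hv.1, ?_⟩
    rintro (rfl | rfl)
    · exact absurd (hv.2 1 m1 h.1.symm) (by norm_num)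
    · exact absurd (hv.2 1 m1 h.2.symm) (by norm_num)
  have heq := Finset.eq_of_subset_of_card_le hsub (by
    rw [hf.card_filter_isRep, Finset.card_sdiff_of_subset
      (by simp [Finset.insert_subset_iff]; omega), Nat.card_Icc]
    simp)
  have : s ∈ (Finset.Icc 1 n).filter (IsRep n f) := by
    rw [heq, Finset.mem_sdiff, Finset.mem_insert, Finset.mem_singleton]
    exact ⟨hs, by omega⟩
  exact (Finset.mem_filter.1 this).2

theorem initialTriangle_eq_on_face (hn : 5 ≤ n) (hs : s ∈ Finset.Icc 1 n)
    (ht₁ : t₁ ∈ Finset.Icc 1 n) (ht₂ : t₂ ∈ Finset.Icc 1 n) (h₁ : t₁ < t₂) (h₂ : t₂ < s)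
    (h₃ : 4 ≤ s) (h : t₂ ≤ 3) {x : GPoint} (hx : x ∈ PolyP n (n - 2))
    (hxf : triangle s t₁ t₂ x = 1) : initialTriangle n x = 3 - (n - 2 : ℕ) := by
  classical
  have hlow : (3 : ℝ) - (n - 2 : ℕ) ≤ initialTriangle n x := by
    refine convexHull_min ?_ (convex_halfSpace_ge (initialTriangle n).isLinear _) hx
    rintro _ ⟨π, rfl⟩
    obtain ⟨f, hf, hfπ⟩ := exists_labelling π
    rw [Set.mem_ofPred_eq, hfπ, hf.initialTriangle_labelVec (by omega)]
    split_ifs <;> linarith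
  have hupp : (initialTriangle n + triangle s t₁ t₂) x ≤ 4 - (n - 2 : ℕ) := by
    refine convexHull_min ?_ (convex_halfSpace_le (initialTriangle n + triangle s t₁ t₂).isLinear _) hx
    rintro _ ⟨π, rfl⟩
    obtain ⟨f, hf, hfπ⟩ := exists_labelling π
    rw [Set.mem_ofPred_eq, LinearMap.add_apply, hfπ, hf.initialTriangle_labelVec (by omega)]
    by_cases heq : f 2 = f 1 ∧ f 3 = f 1
    · have hrep := hf.isRep_of_eq (by omega) heq hs h₃
      have hs₁ : f s ≠ f t₁ := fun h => absurd (hrep t₁ ht₁ h.symm) (by omega)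
      have hs₂ : f s ≠ f t₂ := fun h => absurd (hrep t₂ ht₂ h.symm) (by omega)
      have ht : f t₁ = f t₂ := by
        have := (Finset.mem_Icc.1 ht₁).1
        obtain ⟨rfl, rfl⟩ | ⟨rfl, rfl⟩ | ⟨rfl, rfl⟩ :
            (t₁ = 1 ∧ t₂ = 2) ∨ (t₁ = 1 ∧ t₂ = 3) ∨ (t₁ = 2 ∧ t₂ = 3) := by omega
        · exact heq.1.symm
        · exact heq.2.symm
        · exact heq.1.trans heq.2.symm
      rw [if_pos heq, triangle_apply, labelVec_fst hs ht₁, labelVec_fst hs ht₂,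
        labelVec_fst ht₁ ht₂, labelVec_snd, if_neg hs₁, if_neg hs₂, if_pos ht,
        if_pos ⟨h₃, hs, hrep⟩]
      linarith
    · rw [if_neg heq]
      have := (triangle_labelVec_le_and_eq_iff hs ht₁ ht₂ h₁ h₂ h₃ f).1
      linarith
  rw [LinearMap.add_apply, hxf] at hupp
  linarith

theorem adim_face_add_one_ne_of_le_three (hn : 5 ≤ n) (hs : s ∈ Finset.Icc 1 n)
    (ht₁ : t₁ ∈ Finset.Icc 1 n) (ht₂ : t₂ ∈ Finset.Icc 1 n) (h₁ : t₁ < t₂) (h₂ : t₂ < s)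
    (h₃ : 4 ≤ s) (h : t₂ ≤ 3) :
    adim {x | x ∈ PolyP n (n - 2) ∧ triangle s t₁ t₂ x = 1} + 1 ≠ adim (PolyP n (n - 2)) := by
  classical
  have htri := fun {L : Type} (f : ℕ → L) =>
    triangle_labelVec_le_and_eq_iff hs ht₁ ht₂ h₁ h₂ h₃ f
  have ht₁1 := (Finset.mem_Icc.1 ht₁).1
  obtain ⟨u, hu1, hu3, hut₁, hut₂⟩ : ∃ u, 1 ≤ u ∧ u ≤ 3 ∧ u ≠ t₁ ∧ u ≠ t₂ := by
    by_contra! hcon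
    have := hcon 1
    have := hcon 2
    have := hcon 3
    omega
  have hu : u ∈ Finset.Icc 1 n := Finset.mem_Icc.2 (by omega)
  have hus : s ≠ u := by omega
  have hst₁ : s ≠ t₁ := by omega
  have hcard : (Finset.Icc 1 n).card = n := by rw [Nat.card_Icc]; omega
  obtain ⟨f, hf, ft₁, -, fs, -⟩ := exists_triangle_labelling (K := n - 2) (by omega) le_rfl hs ht₁
    ht₂ h₁ h₂ 0 1 0 2 1 (by decide) (by norm_num) (by norm_num)
  have hD₀ : ({t₁, t₂, u, s} : Finset ℕ) ⊆ Finset.Icc 1 n := by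
    simp only [Finset.insert_subset_iff, Finset.singleton_subset_iff]
    exact ⟨ht₁, ht₂, hu, hs⟩
  have hcard₀ : ({t₁, t₂, u, s} : Finset ℕ).card ≤ 4 := Finset.card_le_four
  obtain ⟨f₀, hf₀, hfD₀, -⟩ := exists_extension (K := n - 2) (k := 3) (c₀ := 0) hD₀
    (f₀ := fun x => if x = u then 1 else if x = s then 2 else 0)
    (by simp [Finset.image_insert, hut₁.symm, hut₂.symm, hst₁.symm, h₂.ne, hus]; decide)
    (by norm_num) (by omega) (by omega)
  have hD₁ : Finset.Icc 1 3 ⊆ Finset.Icc 1 n := Finset.Icc_subset_Icc_right (by omega)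
  obtain ⟨f₁, hf₁, hfD₁, -⟩ := exists_extension (K := n - 2) (k := 1) (c₀ := 0) hD₁
    (f₀ := fun _ => 0) (by decide) (by norm_num) (by omega) (by rw [Nat.card_Icc]; omega)
  obtain ⟨π, hπ⟩ := exists_kPartition hf
  obtain ⟨π₀, hπ₀⟩ := exists_kPartition hf₀
  obtain ⟨π₁, hπ₁⟩ := exists_kPartition hf₁
  refine adim_face_add_one_ne (finite_charVecs n (n - 2)) (x₀ := charVec n _ π)
    (y₀ := charVec n _ π₀) (y₁ := charVec n _ π₁) ⟨π, rfl⟩ ?_ ⟨π₀, rfl⟩ ?_ ⟨π₁, rfl⟩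
    (g := initialTriangle n) (c := 3 - (n - 2 : ℕ))
    (fun x => initialTriangle_eq_on_face hn hs ht₁ ht₂ h₁ h₂ h₃ h) ?_ ?_
  · rw [hπ, (htri f).2]
    exact .inl (fs.trans ft₁.symm)
  · rw [hπ₀, Ne, (htri f₀).2]
    simp [OnFace, hfD₀, hus, hut₁.symm, hut₂.symm, hst₁.symm, h₂.ne]
  · rw [hπ₀, hf₀.initialTriangle_labelVec (by omega), if_neg, add_zero]
    rintro ⟨h21, h31⟩
    have hall : ∀ x, 1 ≤ x → x ≤ 3 → f₀ x = f₀ 1 := by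
      intro x hx1 hx3
      obtain rfl | rfl | rfl : x = 1 ∨ x = 2 ∨ x = 3 := by omega
      · rfl
      · exact h21
      · exact h31
    have := (hall u hu1 hu3).trans (hall t₁ ht₁1 (by omega)).symm
    simp [hfD₀, hut₁.symm, hst₁.symm] at this
  · rw [hπ₁, hf₁.initialTriangle_labelVec (by omega), if_pos]
    · linarith
    · simp [hfD₁]

end NotFacet

end StrengthenedTriangle

/-- For `n ≥ 5`, `3 ≤ K ≤ n-2` and `t₁ < t₂ < s` in `V` with `s ≥ 4`, the strengthened
triangle inequality `x_{s,t₁} + x_{s,t₂} - x_{t₁,t₂} + x_s ≤ 1` is facet-defining for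
`P_{n,K}` iff `t₂ ≥ 4` or `K ≤ n-3`. -/
theorem strengthened_triangle_facet (n K s t₁ t₂ : ℕ) (hn : 5 ≤ n) (hK1 : 3 ≤ K)
    (hK2 : K ≤ n - 2) (hs : s ∈ Finset.Icc 1 n) (ht₁ : t₁ ∈ Finset.Icc 1 n)
    (ht₂ : t₂ ∈ Finset.Icc 1 n) (h₁ : t₁ < t₂) (h₂ : t₂ < s) (h₃ : 4 ≤ s) :
    IsFacetLe n K (fun x => x.1 (s, t₁) + x.1 (s, t₂) - x.1 (t₁, t₂) + x.2 s) 1 ↔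
      (4 ≤ t₂ ∨ K ≤ n - 3) := by
  constructor
  · rintro ⟨-, hdim⟩
    by_contra! hcon
    obtain rfl : K = n - 2 := by omega
    exact StrengthenedTriangle.adim_face_add_one_ne_of_le_three hn hs ht₁ ht₂ h₁ h₂ h₃ (by omega)
      hdim
  · intro h
    refine ⟨fun x hx => StrengthenedTriangle.triangle_le_one hs ht₁ ht₂ h₁ h₂ h₃ hx,
      StrengthenedTriangle.adim_face_add_one_of_supported hK1 hK2 hs ht₁ ht₂ h₁ h₂ h₃
        fun g c hg => ?_⟩
    by_cases hn6 : 6 ≤ n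
    · exact hg.supportedOnTriangle_of_six_le hn6 hK1 hK2 hs ht₁ ht₂ h₁ h₂ h₃ h
    · have hs' := Finset.mem_Icc.1 hs
      have ht₁' := Finset.mem_Icc.1 ht₁
      obtain rfl : n = 5 := by omega
      obtain rfl : K = 3 := by omega
      obtain rfl : t₂ = 4 := by omega
      obtain rfl : s = 5 := by omega
      exact hg.supportedOnTriangle_of_five ht₁'.1 (by omega)
end

section
/- Let n ≥ 5 and 3 ≤ K ≤ n−2, and let a, b, c, d be pairwise distinct vertices of V. The paw inequality x^π_{a,b} + x^π_{b,c} − x^π_{a,c} + x^π_{c,d} + y^π_b + y^π_c ≤ 2 holds for every K-partition π of V if and only if a < b and d = min(b,c,d). -/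
open Classical in
/-- `x^π_{u,v}`: the same-cluster indicator of `u` and `v` in `π`. -/
noncomputable def scInd (n K : ℕ) (π : KPartition n K) (u v : ℕ) : ℝ :=
  if ∃ C ∈ π.parts, u ∈ C ∧ v ∈ C then 1 else 0

open Classical in
/-- `y^π_v`: the representative indicator of `v` in `π` (`1` iff `v` is the smallest element
of its cluster), defined for every vertex `v`. -/
noncomputable def repInd (n K : ℕ) (π : KPartition n K) (v : ℕ) : ℝ :=
  if ∃ C ∈ π.parts, v ∈ C ∧ ∀ w ∈ C, v ≤ w then 1 else 0

theorem KPartition.eq_of_mem {n K : ℕ} (π : KPartition n K) {C D : Finset ℕ} {u : ℕ}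
    (hC : C ∈ π.parts) (hD : D ∈ π.parts) (huC : u ∈ C) (huD : u ∈ D) : C = D := by
  by_contra h
  exact Finset.disjoint_left.mp (π.parts_disjoint C hC D hD h) huC huD

theorem KPartition.exists_mem {n K : ℕ} (π : KPartition n K) {u : ℕ}
    (hu : u ∈ Finset.Icc 1 n) : ∃ C ∈ π.parts, u ∈ C := by
  rw [← π.parts_cover, Finset.mem_sup] at hu
  exact hu

theorem scInd_of_mem {n K : ℕ} (π : KPartition n K) {C : Finset ℕ} {u : ℕ}
    (hC : C ∈ π.parts) (hu : u ∈ C) (v : ℕ) :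
    scInd n K π u v = if v ∈ C then 1 else 0 := by
  have h : (∃ D ∈ π.parts, u ∈ D ∧ v ∈ D) ↔ v ∈ C :=
    ⟨fun ⟨D, hD, huD, hvD⟩ => π.eq_of_mem hD hC huD hu ▸ hvD, fun hv => ⟨C, hC, hu, hv⟩⟩
  simp [scInd, h]

open Classical in
theorem repInd_of_mem {n K : ℕ} (π : KPartition n K) {C : Finset ℕ} {u : ℕ}
    (hC : C ∈ π.parts) (hu : u ∈ C) :
    repInd n K π u = if ∀ w ∈ C, u ≤ w then 1 else 0 := by
  have h : (∃ D ∈ π.parts, u ∈ D ∧ ∀ w ∈ D, u ≤ w) ↔ ∀ w ∈ C, u ≤ w :=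
    ⟨fun ⟨D, hD, huD, hvD⟩ => π.eq_of_mem hD hC huD hu ▸ hvD, fun hv => ⟨C, hC, hu, hv⟩⟩
  simp [repInd, h]

/-- The `K`-partition given by a `Finpartition` of `{1,…,n}` with `K` parts. -/
def KPartition.ofFinpartition {n K : ℕ} (P : Finpartition (Finset.Icc 1 n))
    (hP : P.parts.card = K) : KPartition n K where
  parts := P.parts
  card_parts := hP
  parts_nonempty _ hC := P.nonempty_of_mem_parts hC
  parts_disjoint _ hC _ hD h := P.disjoint hC hD h
  parts_cover := P.sup_parts

/-- Two disjoint nonempty sets extend to a `K`-partition when enough vertices remain. -/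
theorem KPartition.exists_of_disjoint {n K : ℕ} {S T : Finset ℕ} (hS : S.Nonempty)
    (hT : T.Nonempty) (hST : Disjoint S T) (hSn : S ⊆ Finset.Icc 1 n)
    (hTn : T ⊆ Finset.Icc 1 n) (hK : 3 ≤ K) (hcard : K + S.card + T.card ≤ n + 2) :
    ∃ π : KPartition n K, S ∈ π.parts ∧ T ∈ π.parts := by
  have hunion : S ∪ T ⊆ Finset.Icc 1 n := Finset.union_subset hSn hTn
  have hR : K - 2 ≤ (Finset.Icc 1 n \ (S ∪ T)).card := by
    rw [Finset.card_sdiff_of_subset hunion, Finset.card_union_of_disjoint hST, Nat.card_Icc]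
    omega
  obtain ⟨P, -, hP⟩ := Finpartition.exists_equipartition_card_eq _ (by omega : K - 2 ≠ 0) hR
  have hRT : Disjoint (Finset.Icc 1 n \ (S ∪ T)) T :=
    Finset.sdiff_disjoint.mono_right Finset.subset_union_right
  have hRS : Disjoint (Finset.Icc 1 n \ (S ∪ T) ⊔ T) S :=
    Disjoint.sup_left (Finset.sdiff_disjoint.mono_right Finset.subset_union_left) hST.symm
  have hcover : Finset.Icc 1 n \ (S ∪ T) ⊔ T ⊔ S = Finset.Icc 1 n := by
    rw [sup_assoc, sup_comm T S]
    exact Finset.sdiff_union_of_subset hunion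
  refine ⟨.ofFinpartition ((P.extend hT.ne_empty hRT rfl).extend hS.ne_empty hRS hcover) ?_,
    ?_, ?_⟩
  · rw [Finpartition.card_extend, Finpartition.card_extend, hP]
    omega
  · simp [KPartition.ofFinpartition]
  · simp [KPartition.ofFinpartition]

/-- For `n ≥ 5`, `3 ≤ K ≤ n-2` and pairwise distinct `a, b, c, d ∈ V`, the paw inequality
`x^π_{a,b} + x^π_{b,c} - x^π_{a,c} + x^π_{c,d} + y^π_b + y^π_c ≤ 2` holds for every
`K`-partition `π` of `V` iff `a < b` and `d = min(b,c,d)`. -/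
theorem paw_valid_iff (n K a b c d : ℕ) (hn : 5 ≤ n) (hK1 : 3 ≤ K) (hK2 : K ≤ n - 2)
    (ha : a ∈ Finset.Icc 1 n) (hb : b ∈ Finset.Icc 1 n) (hc : c ∈ Finset.Icc 1 n)
    (hd : d ∈ Finset.Icc 1 n)
    (hab : a ≠ b) (hac : a ≠ c) (had : a ≠ d) (hbc : b ≠ c) (hbd : b ≠ d) (hcd : c ≠ d) :
    (∀ π : KPartition n K,
        scInd n K π a b + scInd n K π b c - scInd n K π a c + scInd n K π c d +
          repInd n K π b + repInd n K π c ≤ 2) ↔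
      (a < b ∧ min b (min c d) = d) := by
  constructor
  · intro h
    have sub : ∀ {S : Finset ℕ}, (∀ x ∈ S, x = a ∨ x = b ∨ x = c ∨ x = d) →
        S ⊆ Finset.Icc 1 n := by
      intro S hS x hx
      rcases hS x hx with rfl | rfl | rfl | rfl <;> assumption
    have hle : a < b := by
      by_contra hba
      obtain ⟨π, hS, hT⟩ := KPartition.exists_of_disjoint (n := n) (K := K)
        (S := {a, b}) (T := {c}) (by simp) (by simp) (by simp [hac.symm, hbc.symm])
        (sub (by simp)) (sub (by simp)) hK1
        (by rw [Finset.card_pair hab, Finset.card_singleton]; omega)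
      have := h π
      rw [scInd_of_mem π hS (u := a) (by simp), scInd_of_mem π hS (u := b) (by simp),
        scInd_of_mem π hS (u := a) (by simp), scInd_of_mem π hT (u := c) (by simp),
        repInd_of_mem π hS (u := b) (by simp), repInd_of_mem π hT (u := c) (by simp)] at this
      simp [hac.symm, hbc.symm, hcd.symm, not_lt.mp hba] at this
      norm_num at this
    have hdc : d < c := by
      by_contra hdc
      obtain ⟨π, hS, hT⟩ := KPartition.exists_of_disjoint (n := n) (K := K)
        (S := {c, d}) (T := {b}) (by simp) (by simp) (by simp [hbc, hbd])
        (sub (by simp)) (sub (by simp)) hK1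
        (by rw [Finset.card_pair hcd, Finset.card_singleton]; omega)
      have := h π
      obtain ⟨A, hA, haA⟩ := π.exists_mem ha
      have hab' : b ∉ A := fun hbA => by
        have := π.eq_of_mem hA hT hbA (by simp)
        simp [this, hab] at haA
      have hac' : c ∉ A := fun hcA => by
        have := π.eq_of_mem hA hS hcA (by simp)
        simp [this, hac, had] at haA
      rw [scInd_of_mem π hA haA, scInd_of_mem π hT (u := b) (by simp),
        scInd_of_mem π hA haA, scInd_of_mem π hS (u := c) (by simp),
        repInd_of_mem π hT (u := b) (by simp), repInd_of_mem π hS (u := c) (by simp)] at this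
      simp [hab', hac', hbc.symm, not_lt.mp hdc] at this
      norm_num at this
    have hdb : d < b := by
      by_contra hdb
      obtain ⟨π, hS, hT⟩ := KPartition.exists_of_disjoint (n := n) (K := K)
        (S := {b, c, d}) (T := {a}) (by simp) (by simp) (by simp [hab, hac, had])
        (sub (by simp)) (sub (by simp)) hK1
        (by rw [Finset.card_eq_three.mpr ⟨b, c, d, hbc, hbd, hcd, rfl⟩,
          Finset.card_singleton]; omega)
      have := h π
      have hbc' : b ≤ c := by omega
      have hcd' : ¬ c ≤ d := by omega
      rw [scInd_of_mem π hT (u := a) (by simp), scInd_of_mem π hS (u := b) (by simp),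
        scInd_of_mem π hT (u := a) (by simp), scInd_of_mem π hS (u := c) (by simp),
        repInd_of_mem π hS (u := b) (by simp), repInd_of_mem π hS (u := c) (by simp)] at this
      simp [hab.symm, hac.symm, not_lt.mp hdb, hbc', hcd'] at this
      norm_num at this
    exact ⟨hle, by omega⟩
  · rintro ⟨hlt, hmin⟩ π
    have hdb : d < b := by omega
    have hdc : d < c := by omega
    obtain ⟨A, hA, haA⟩ := π.exists_mem ha
    obtain ⟨B, hB, hbB⟩ := π.exists_mem hb
    obtain ⟨C, hC, hcC⟩ := π.exists_mem hc
    rw [scInd_of_mem π hA haA, scInd_of_mem π hB hbB, scInd_of_mem π hA haA,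
      scInd_of_mem π hC hcC, repInd_of_mem π hB hbB, repInd_of_mem π hC hcC]
    have hAB : b ∈ A → A = B := fun h => π.eq_of_mem hA hB h hbB
    have hBC : c ∈ B → B = C := fun h => π.eq_of_mem hB hC h hcC
    have hab' : b ∈ A → ¬ ∀ w ∈ B, b ≤ w := fun h hw =>
      absurd (hw a (hAB h ▸ haA)) (by omega)
    have hcd' : d ∈ C → ¬ ∀ w ∈ C, c ≤ w := fun h hw => absurd (hw d h) (by omega)
    have hbd' : c ∈ B → d ∈ C → ¬ ∀ w ∈ B, b ≤ w := fun h h' hw =>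
      absurd (hw d (hBC h ▸ h')) (by omega)
    have hbc' : c ∈ B → (∀ w ∈ B, b ≤ w) → ¬ ∀ w ∈ C, c ≤ w := fun h hw hw' =>
      hbc (le_antisymm (hw c h) (hw' b (hBC h ▸ hbB)))
    have habc : b ∈ A → c ∈ B → c ∈ A := fun h h' => hAB h ▸ h'
    split_ifs <;> first
      | (norm_num; done)
      | exact absurd ‹_› (hab' ‹_›)
      | exact absurd ‹_› (hcd' ‹_›)
      | exact absurd ‹_› (hbd' ‹_› ‹_›)
      | exact absurd ‹_› (hbc' ‹_› ‹_›)
      | exact absurd (habc ‹_› ‹_›) ‹_›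
end

section
/- Let n ≥ 5 and 3 ≤ K ≤ n−2, and let a, b, c, d be pairwise distinct vertices of V with b, c ∈ {4,…,n}, a < b and d = min(b,c,d). If c < b or K = n−2, then the face F_P = {x ∈ P_{n,K} : x_{a,b} + x_{b,c} − x_{a,c} + x_{c,d} + x_b + x_c = 2} of P_{n,K} defined by the paw inequality is not a facet of P_{n,K}, i.e., its affine dimension is not equal to dim(P_{n,K}) − 1. -/
section Dimension

/-- If two linear functionals are constant on `F ⊆ P`, while their joint values on `P` affinely
span the plane, then `F` has codimension at least two in `P`. -/
theorem adim_add_one_ne {F P : Set GPoint} (hFP : F ⊆ P)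
    [FiniteDimensional ℝ (affineSpan ℝ P).direction] (f g : GPoint →ₗ[ℝ] ℝ) {α β : ℝ}
    (hf : ∀ x ∈ F, f x = α) (hg : ∀ x ∈ F, g x = β) {p q r : GPoint}
    (hp : p ∈ P) (hq : q ∈ P) (hr : r ∈ P)
    (hgpq : g p = g q) (hfpq : f p ≠ f q) (hgr : g r ≠ g q) :
    adim F + 1 ≠ adim P := by
  have hconst : ∀ (h : GPoint →ₗ[ℝ] ℝ) (γ : ℝ), (∀ x ∈ F, h x = γ) →
      (affineSpan ℝ F).direction ≤ LinearMap.ker h := by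
    intro h γ hγ
    rw [direction_affineSpan, vectorSpan_def, Submodule.span_le]
    rintro _ ⟨x, hx, y, hy, rfl⟩
    simp [hγ x hx, hγ y hy]
  have hdiff : ∀ x ∈ P, ∀ y ∈ P, x - y ∈ (affineSpan ℝ P).direction := by
    intro x hx y hy
    rw [direction_affineSpan]
    exact vsub_mem_vectorSpan ℝ hx hy
  set D := (affineSpan ℝ P).direction
  set M := LinearMap.ker g ⊓ D
  have hFM : (affineSpan ℝ F).direction < M := by
    refine lt_of_le_of_ne
      (le_inf (hconst g β hg) (AffineSubspace.direction_le (affineSpan_mono ℝ hFP))) fun h => ?_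
    have hmem : p - q ∈ M := ⟨by simp [hgpq], hdiff p hp q hq⟩
    rw [← h] at hmem
    have := hconst f α hf hmem
    rw [LinearMap.mem_ker, map_sub, sub_eq_zero] at this
    exact hfpq this
  have hMD : M < D := by
    refine lt_of_le_of_ne inf_le_right fun h => ?_
    have hmem := hdiff r hr q hq
    rw [← h] at hmem
    have := hmem.1
    rw [SetLike.mem_coe, LinearMap.mem_ker, map_sub, sub_eq_zero] at this
    exact hgr this
  have : FiniteDimensional ℝ M := Submodule.finiteDimensional_of_le inf_le_right
  have h₁ : Module.finrank ℝ _ < Module.finrank ℝ M := Submodule.finrank_lt_finrank_of_lt hFM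
  have h₂ : Module.finrank ℝ M < Module.finrank ℝ D := Submodule.finrank_lt_finrank_of_lt hMD
  exact ((Nat.succ_le_of_lt h₁).trans_lt h₂).ne

theorem finite_range_charVec (n K : ℕ) :
    {x | ∃ π : KPartition n K, x = charVec n K π}.Finite := by
  have hinj : Function.Injective (KPartition.parts : KPartition n K → _) := by
    rintro ⟨⟩ ⟨⟩ h
    simpa using h
  have : Finite (KPartition n K) := by
    refine Set.finite_univ_iff.1 (Set.Finite.of_finite_image (f := KPartition.parts)
      (((Finset.Icc 1 n).powerset.powerset.finite_toSet).subset ?_) hinj.injOn)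
    rintro _ ⟨π, -, rfl⟩
    simp only [Finset.mem_coe, Finset.mem_powerset]
    intro C hC
    rw [Finset.mem_powerset, ← π.parts_cover]
    exact Finset.le_sup (f := id) hC
  refine (Set.finite_range (charVec n K)).subset ?_
  rintro _ ⟨π, rfl⟩
  exact ⟨π, rfl⟩

instance finiteDimensional_direction_PolyP (n K : ℕ) :
    FiniteDimensional ℝ (affineSpan ℝ (PolyP n K)).direction := by
  rw [PolyP, affineSpan_convexHull, direction_affineSpan]
  exact finiteDimensional_vectorSpan_of_finite ℝ (finite_range_charVec n K)

theorem charVec_mem_PolyP {n K : ℕ} (π : KPartition n K) : charVec n K π ∈ PolyP n K :=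
  subset_convexHull ℝ _ ⟨π, rfl⟩

theorem le_of_mem_PolyP {n K : ℕ} (f : GPoint →ₗ[ℝ] ℝ) {β : ℝ}
    (h : ∀ π : KPartition n K, f (charVec n K π) ≤ β) {x : GPoint} (hx : x ∈ PolyP n K) :
    f x ≤ β := by
  refine convexHull_min ?_ (convex_halfSpace_le f.isLinear β) hx
  rintro _ ⟨π, rfl⟩
  exact h π

/-- The edge coordinate `x_{u,v}`. -/
noncomputable def edgeCoord (u v : ℕ) : GPoint →ₗ[ℝ] ℝ :=
  (LinearMap.proj (u, v) : (ℕ × ℕ → ℝ) →ₗ[ℝ] ℝ) ∘ₗ LinearMap.fst ℝ _ _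

/-- The representative coordinate `x_v`. -/
noncomputable def repCoord (v : ℕ) : GPoint →ₗ[ℝ] ℝ :=
  (LinearMap.proj v : (ℕ → ℝ) →ₗ[ℝ] ℝ) ∘ₗ LinearMap.snd ℝ _ _

@[simp] theorem edgeCoord_apply (u v : ℕ) (x : GPoint) : edgeCoord u v x = x.1 (u, v) := rfl

@[simp] theorem repCoord_apply (v : ℕ) (x : GPoint) : repCoord v x = x.2 v := rfl

end Dimension

namespace KPartition

variable {n K : ℕ} (π : KPartition n K)

/-- Two vertices lie in the same cluster. -/
def Same (u v : ℕ) : Prop := ∃ C ∈ π.parts, u ∈ C ∧ v ∈ C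

/-- A vertex is the smallest element of its cluster. -/
def IsRep (v : ℕ) : Prop := ∃ C ∈ π.parts, v ∈ C ∧ ∀ w ∈ C, v ≤ w

variable {π}

theorem eq_of_mem_s13 {C D : Finset ℕ} (hC : C ∈ π.parts) (hD : D ∈ π.parts) {v : ℕ}
    (hvC : v ∈ C) (hvD : v ∈ D) : C = D := by
  by_contra h
  exact Finset.disjoint_left.1 (π.parts_disjoint C hC D hD h) hvC hvD

theorem Same.symm {u v : ℕ} (h : π.Same u v) : π.Same v u := by
  obtain ⟨C, hC, hu, hv⟩ := h
  exact ⟨C, hC, hv, hu⟩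

theorem Same.trans {u v w : ℕ} (h : π.Same u v) (h' : π.Same v w) : π.Same u w := by
  obtain ⟨C, hC, hu, hv⟩ := h
  obtain ⟨D, hD, hv', hw⟩ := h'
  obtain rfl := eq_of_mem_s13 hC hD hv hv'
  exact ⟨C, hC, hu, hw⟩

theorem IsRep.le {u v : ℕ} (h : π.IsRep v) (h' : π.Same u v) : v ≤ u := by
  obtain ⟨C, hC, hv, hmin⟩ := h
  obtain ⟨D, hD, hu, hv'⟩ := h'
  obtain rfl := eq_of_mem_s13 hC hD hv hv'
  exact hmin u hu

theorem same_iff_of_mem {A : Finset ℕ} (hA : A ∈ π.parts) {u v : ℕ} (hu : u ∈ A) :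
    π.Same u v ↔ v ∈ A := by
  refine ⟨?_, fun hv => ⟨A, hA, hu, hv⟩⟩
  rintro ⟨C, hC, hu', hv⟩
  rwa [eq_of_mem_s13 hA hC hu hu']

theorem same_iff_of_mem' {A : Finset ℕ} (hA : A ∈ π.parts) {u v : ℕ} (hu : u ∈ A) :
    π.Same v u ↔ v ∈ A :=
  ⟨fun h => (same_iff_of_mem hA hu).1 h.symm, fun h => ((same_iff_of_mem hA hu).2 h).symm⟩

theorem isRep_iff_of_mem {A : Finset ℕ} (hA : A ∈ π.parts) {v : ℕ} (hv : v ∈ A) :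
    π.IsRep v ↔ ∀ w ∈ A, v ≤ w := by
  refine ⟨?_, fun h => ⟨A, hA, hv, h⟩⟩
  rintro ⟨C, hC, hv', h⟩
  rwa [eq_of_mem_s13 hA hC hv hv']

open Classical in
theorem charVec_fst (u v : ℕ) : (charVec n K π).1 (u, v) = if π.Same u v then 1 else 0 := by
  simp only [charVec, Same]
  congr

open Classical in
theorem charVec_snd {v : ℕ} (hv : 4 ≤ v) :
    (charVec n K π).2 v = if π.IsRep v then 1 else 0 := by
  simp only [charVec, IsRep, hv, true_and]
  congr

theorem card_add_le {C : Finset ℕ} (hC : C ∈ π.parts) : C.card + K ≤ n + 1 := by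
  have hsum : ∑ D ∈ π.parts, D.card = n := by
    have := Finset.card_biUnion (s := π.parts) (t := id)
      (fun C hC D hD h => π.parts_disjoint C hC D hD h)
    rw [← Finset.sup_eq_biUnion, π.parts_cover] at this
    simpa using this.symm
  have hrest : (π.parts.erase C).card ≤ ∑ D ∈ π.parts.erase C, D.card := by
    simpa using Finset.card_nsmul_le_sum (π.parts.erase C) Finset.card 1
      fun D hD => (π.parts_nonempty D (Finset.mem_of_mem_erase hD)).card_pos
  rw [Finset.card_erase_of_mem hC, π.card_parts] at hrest
  have := Finset.add_sum_erase π.parts Finset.card hC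
  omega

variable (n K) in
theorem exists_mem_mem (hK1 : 3 ≤ K) (hK2 : K ≤ n - 2) {A B : Finset ℕ}
    (hA : A ⊆ Finset.Icc 1 n) (hB : B ⊆ Finset.Icc 1 n) (hAne : A.Nonempty) (hBne : B.Nonempty)
    (hAB : Disjoint A B) (hcard : A.card + B.card ≤ 4) :
    ∃ π : KPartition n K, A ∈ π.parts ∧ B ∈ π.parts := by
  have hABcard : (A ∪ B).card = A.card + B.card := Finset.card_union_of_disjoint hAB
  have hR : (Finset.Icc 1 n \ (A ∪ B)).card = n - (A.card + B.card) := by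
    rw [Finset.card_sdiff_of_subset (Finset.union_subset hA hB), hABcard]
    simp
  obtain ⟨T, hT, hTcard⟩ := Finset.exists_subset_card_eq
    (s := Finset.Icc 1 n \ (A ∪ B)) (n := K - 3) (by omega)
  set C := (Finset.Icc 1 n \ (A ∪ B)) \ T with hCdef
  have hCne : C.Nonempty := by
    rw [← Finset.card_pos, Finset.card_sdiff_of_subset hT]
    omega
  have hAC : Disjoint A C := Finset.disjoint_left.2 fun x hx hx' => by
    simp [hCdef, hx] at hx'
  have hBC : Disjoint B C := Finset.disjoint_left.2 fun x hx hx' => by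
    simp [hCdef, hx] at hx'
  have hTA : ∀ t ∈ T, t ∉ A := fun t ht h => by simpa [h] using hT ht
  have hTB : ∀ t ∈ T, t ∉ B := fun t ht h => by simpa [h] using hT ht
  have hTC : ∀ t ∈ T, t ∉ C := fun t ht h => by simp [hCdef, ht] at h
  have hne : ∀ {X Y : Finset ℕ}, X.Nonempty → Disjoint X Y → X ≠ Y := by
    rintro X _ hX h rfl
    exact hX.ne_empty (disjoint_self.1 h)
  have hnotT : ∀ {X : Finset ℕ}, (∀ t ∈ T, t ∉ X) → X ∉ T.image singleton := by
    intro X h hX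
    obtain ⟨t, ht, rfl⟩ := Finset.mem_image.1 hX
    exact h t ht (Finset.mem_singleton_self t)
  refine ⟨⟨insert A (insert B (insert C (T.image singleton))), ?_, ?_, ?_, ?_⟩, ?_, ?_⟩
  · rw [Finset.card_insert_of_notMem, Finset.card_insert_of_notMem, Finset.card_insert_of_notMem,
      Finset.card_image_of_injective _ Finset.singleton_injective, hTcard]
    · omega
    · exact hnotT hTC
    · simpa [hne hBne hBC] using hnotT hTB
    · simpa [hne hAne hAB, hne hAne hAC] using hnotT hTA
  · intro X hX
    simp only [Finset.mem_insert, Finset.mem_image] at hX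
    obtain rfl | rfl | rfl | ⟨t, -, rfl⟩ := hX
    exacts [hAne, hBne, hCne, Finset.singleton_nonempty t]
  · intro X hX Y hY hXY
    simp only [Finset.mem_insert, Finset.mem_image] at hX hY
    obtain rfl | rfl | rfl | ⟨t, ht, rfl⟩ := hX <;>
      obtain rfl | rfl | rfl | ⟨s, hs, rfl⟩ := hY <;>
      simp_all [disjoint_comm]
  · ext x
    have hAx := @hA x
    have hBx := @hB x
    have hTx := @hT x
    simp only [Finset.mem_sup, Finset.mem_insert, Finset.mem_image, id, hCdef]
    constructor
    · rintro ⟨X, rfl | rfl | rfl | ⟨t, ht, rfl⟩, hx⟩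
      · exact hAx hx
      · exact hBx hx
      · simp only [Finset.mem_sdiff] at hx
        exact hx.1.1
      · obtain rfl := Finset.mem_singleton.1 hx
        exact (Finset.mem_sdiff.1 (hTx ht)).1
    · intro hx
      by_cases h₁ : x ∈ A
      · exact ⟨A, by simp, h₁⟩
      by_cases h₂ : x ∈ B
      · exact ⟨B, by simp, h₂⟩
      by_cases h₃ : x ∈ T
      · exact ⟨{x}, by simp [h₃], by simp⟩
      · exact ⟨_, Or.inr (Or.inr (Or.inl rfl)), by simp_all⟩
  · simp
  · simp

variable (n K) in
theorem exists_pair_mem_pair_mem (hK1 : 3 ≤ K) (hK2 : K ≤ n - 2) {s t u v : ℕ}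
    (hs : 1 ≤ s ∧ s ≤ n) (ht : 1 ≤ t ∧ t ≤ n) (hu : 1 ≤ u ∧ u ≤ n) (hv : 1 ≤ v ∧ v ≤ n)
    (hsu : s ≠ u) (hsv : s ≠ v) (htu : t ≠ u) (htv : t ≠ v) :
    ∃ π : KPartition n K, {s, t} ∈ π.parts ∧ {u, v} ∈ π.parts :=
  exists_mem_mem n K hK1 hK2 (by simp [Finset.insert_subset_iff, hs, ht])
    (by simp [Finset.insert_subset_iff, hu, hv]) (by simp) (by simp)
    (by simp [hsu.symm, hsv.symm, htu.symm, htv.symm]) (add_le_add Finset.card_le_two Finset.card_le_two)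

end KPartition

open KPartition

/-- The left-hand side of the paw inequality. -/
noncomputable def pawForm (a b c d : ℕ) : GPoint →ₗ[ℝ] ℝ :=
  edgeCoord a b + edgeCoord b c - edgeCoord a c + edgeCoord c d + repCoord b + repCoord c

/-- The face of `P_{n,K}` defined by the paw inequality. -/
def pawFace (n K a b c d : ℕ) : Set GPoint := {x | x ∈ PolyP n K ∧ pawForm a b c d x = 2}

theorem pawForm_sub_charVec_le {n K : ℕ} (π : KPartition n K) {a b c d : ℕ} (hb : 4 ≤ b)
    (hab : a < b) (hcb : c < b) :
    (pawForm a b c d - (edgeCoord c d + repCoord c)) (charVec n K π) ≤ 1 := by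
  have hform : pawForm a b c d - (edgeCoord c d + repCoord c)
      = edgeCoord a b + edgeCoord b c - edgeCoord a c + repCoord b := by
    rw [pawForm]
    abel
  have hrep₁ : π.IsRep b → ¬ π.Same a b := fun h h' => absurd (h.le h') hab.not_ge
  have hrep₂ : π.IsRep b → ¬ π.Same b c := fun h h' => absurd (h.le h'.symm) hcb.not_ge
  have htrans : π.Same a b → π.Same b c → π.Same a c := Same.trans
  simp only [hform, LinearMap.add_apply, LinearMap.sub_apply, edgeCoord_apply,
    repCoord_apply, charVec_fst, charVec_snd hb]
  split_ifs <;> first | (norm_num; done) | simp_all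

theorem pawForm_add_charVec_le {n K : ℕ} (π : KPartition n K) {a b c d : ℕ} (hK : n < K + 3)
    (hb : 4 ≤ b) (hc : 4 ≤ c) (hab : a ≠ b) (hac : a ≠ c) (had : a ≠ d) (hcd : c ≠ d)
    (hlt : a < b) (hdb : d < b) (hdc : d < c) (hbc : b < c) :
    (pawForm a b c d + edgeCoord a c) (charVec n K π) ≤ 2 := by
  have hform : pawForm a b c d + edgeCoord a c
      = edgeCoord a b + edgeCoord b c + edgeCoord c d + repCoord b + repCoord c := by
    rw [pawForm]
    abel
  have hrep₁ : π.IsRep b → ¬ π.Same a b := fun h h' => absurd (h.le h') hlt.not_ge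
  have hrep₂ : π.IsRep c → ¬ π.Same b c := fun h h' => absurd (h.le h') hbc.not_ge
  have hrep₃ : π.IsRep c → ¬ π.Same c d := fun h h' => absurd (h.le h'.symm) hdc.not_ge
  have hrep₄ : π.IsRep b → π.Same b c → ¬ π.Same c d := fun h h' h'' =>
    absurd (h.le (h'.trans h'').symm) hdb.not_ge
  have hsize : π.Same a b → π.Same b c → ¬ π.Same c d := by
    rintro h₁ h₂ ⟨C, hC, hcC, hdC⟩
    have hbC : b ∈ C := (same_iff_of_mem' hC hcC).1 h₂
    have haC : a ∈ C := (same_iff_of_mem' hC hbC).1 h₁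
    have hsub : ({a, b, c, d} : Finset ℕ) ⊆ C := by
      simp [Finset.insert_subset_iff, haC, hbC, hcC, hdC]
    have hcard : ({a, b, c, d} : Finset ℕ).card = 4 := by
      simp [Finset.card_insert_of_notMem, hab, hac, had, hbc.ne, hdb.ne', hcd]
    have := Finset.card_le_card hsub
    have := card_add_le hC
    omega
  simp only [hform, LinearMap.add_apply, edgeCoord_apply, repCoord_apply, charVec_fst,
    charVec_snd hb, charVec_snd hc]
  split_ifs <;> first | (norm_num; done) | simp_all

theorem pawFace_codim_ne_one_of_lt {n K a b c d : ℕ}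
    (hK1 : 3 ≤ K) (hK2 : K ≤ n - 2) (ha : 1 ≤ a ∧ a ≤ n) (hb : 4 ≤ b ∧ b ≤ n)
    (hc : 4 ≤ c ∧ c ≤ n) (hd : 1 ≤ d ∧ d ≤ n)
    (hab : a ≠ b) (hac : a ≠ c) (had : a ≠ d) (hbc : b ≠ c) (hcd : c ≠ d)
    (hlt : a < b) (hdb : d < b) (hdc : d < c) (hcb : c < b) :
    adim (pawFace n K a b c d) + 1 ≠ adim (PolyP n K) := by
  set g : GPoint →ₗ[ℝ] ℝ := edgeCoord c d + repCoord c with hg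
  have hg_le : ∀ x ∈ PolyP n K, g x ≤ 1 := fun x => le_of_mem_PolyP g fun π => by
    have hrep : π.IsRep c → ¬ π.Same c d := fun h h' => absurd (h.le h'.symm) hdc.not_ge
    simp only [hg, LinearMap.add_apply, edgeCoord_apply, repCoord_apply, charVec_fst,
      charVec_snd hc.1]
    split_ifs <;> first | (exfalso; tauto) | norm_num
  have hfg_le : ∀ x ∈ PolyP n K, (pawForm a b c d - g) x ≤ 1 := fun x =>
    le_of_mem_PolyP (pawForm a b c d - g) fun π =>
      pawForm_sub_charVec_le π hb.1 hlt hcb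
  obtain ⟨m, hm, hma, hmd⟩ : ∃ m ∈ Finset.Icc 1 3, m ≠ a ∧ m ≠ d := by
    by_contra! h
    have h₁ := h 1 (by simp)
    have h₂ := h 2 (by simp)
    have h₃ := h 3 (by simp)
    omega
  rw [Finset.mem_Icc] at hm
  have hmc : m < c := by omega
  have hmb : m < b := by omega
  obtain ⟨p, hpA, hpB⟩ := exists_pair_mem_pair_mem n K hK1 hK2
    (s := m) (t := c) (u := b) (v := b)
    (by omega) (by omega) (by omega) (by omega) (by omega) (by omega) (by omega) (by omega)
  rw [Finset.pair_eq_singleton] at hpB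
  obtain ⟨q, hqA, hqB⟩ := exists_pair_mem_pair_mem n K hK1 hK2
    (s := m) (t := c) (u := b) (v := d)
    (by omega) (by omega) (by omega) (by omega) (by omega) (by omega) (by omega) (by omega)
  obtain ⟨r, hrA, hrB⟩ := exists_pair_mem_pair_mem n K hK1 hK2
    (s := c) (t := d) (u := b) (v := b)
    (by omega) (by omega) (by omega) (by omega) (by omega) (by omega) (by omega) (by omega)
  rw [Finset.pair_eq_singleton] at hrB
  have hgp : g (charVec n K p) = 0 := by
    simp [hg, charVec_fst, charVec_snd hc.1, same_iff_of_mem hpA (u := c),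
      isRep_iff_of_mem hpA (v := c), hmc, hmd.symm, hcd.symm]
  have hgq : g (charVec n K q) = 0 := by
    simp [hg, charVec_fst, charVec_snd hc.1, same_iff_of_mem hqA (u := c),
      isRep_iff_of_mem hqA (v := c), hmc, hmd.symm, hcd.symm]
  have hgr : g (charVec n K r) = 1 := by
    simp [hg, charVec_fst, charVec_snd hc.1, same_iff_of_mem hrA (u := c),
      isRep_iff_of_mem hrA (v := c), hdc]
  have hfp : pawForm a b c d (charVec n K p) = 1 := by
    simp [pawForm, charVec_fst, charVec_snd hc.1, charVec_snd hb.1, same_iff_of_mem hpA (u := c),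
      same_iff_of_mem' hpA (u := c), isRep_iff_of_mem hpA (v := c),
      same_iff_of_mem' hpB (u := b),
      isRep_iff_of_mem hpB (v := b), hmc.not_ge, hmb.ne', hmd.symm, hma.symm, hab, hac, hbc,
      hcd.symm]
  have hfq : pawForm a b c d (charVec n K q) = 0 := by
    simp [pawForm, charVec_fst, charVec_snd hc.1, charVec_snd hb.1, same_iff_of_mem hqA (u := c),
      same_iff_of_mem' hqA (u := c), isRep_iff_of_mem hqA (v := c),
      same_iff_of_mem' hqB (u := b),
      isRep_iff_of_mem hqB (v := b), hmc.not_ge, hdb.not_ge, hmb.ne', hmd.symm, hma.symm, hab,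
      hac, had, hbc, hcd.symm]
  refine adim_add_one_ne (fun x hx => hx.1) (pawForm a b c d) g
    (α := 2) (β := 1) (fun x hx => hx.2)
    (fun x hx => ?_) (charVec_mem_PolyP p) (charVec_mem_PolyP q) (charVec_mem_PolyP r)
    (by rw [hgp, hgq]) (by rw [hfp, hfq]; norm_num) (by rw [hgr, hgq]; norm_num)
  have h₁ := hg_le x hx.1
  have h₂ := hfg_le x hx.1
  have h₃ : pawForm a b c d x = 2 := hx.2
  rw [LinearMap.sub_apply] at h₂
  linarith

theorem pawFace_codim_ne_one_of_eq {n K a b c d : ℕ}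
    (hK1 : 3 ≤ K) (hK2 : K ≤ n - 2) (ha : 1 ≤ a ∧ a ≤ n) (hb : 4 ≤ b ∧ b ≤ n)
    (hc : 4 ≤ c ∧ c ≤ n) (hd : 1 ≤ d ∧ d ≤ n)
    (hab : a ≠ b) (hac : a ≠ c) (had : a ≠ d) (hbc : b ≠ c) (hcd : c ≠ d)
    (hlt : a < b) (hdb : d < b) (hdc : d < c) (hbc' : b < c) (hK : K = n - 2) :
    adim (pawFace n K a b c d) + 1 ≠ adim (PolyP n K) := by
  set g : GPoint →ₗ[ℝ] ℝ := edgeCoord a c with hg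
  have hg_le : ∀ x ∈ PolyP n K, (-g) x ≤ 0 := fun x => le_of_mem_PolyP (-g) fun π => by
    simp only [hg, LinearMap.neg_apply, edgeCoord_apply, charVec_fst]
    split_ifs <;> norm_num
  have hfg_le : ∀ x ∈ PolyP n K, (pawForm a b c d + g) x ≤ 2 := fun x =>
    le_of_mem_PolyP (pawForm a b c d + g) fun π =>
      pawForm_add_charVec_le π (by omega) hb.1 hc.1 hab hac had hcd hlt hdb hdc hbc'
  obtain ⟨p, hpA, hpB⟩ := exists_pair_mem_pair_mem n K hK1 hK2
    (s := b) (t := b) (u := c) (v := c)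
    (by omega) (by omega) (by omega) (by omega) (by omega) (by omega) (by omega) (by omega)
  rw [Finset.pair_eq_singleton] at hpA hpB
  obtain ⟨q, hqA, hqB⟩ := exists_pair_mem_pair_mem n K hK1 hK2
    (s := b) (t := d) (u := c) (v := c)
    (by omega) (by omega) (by omega) (by omega) (by omega) (by omega) (by omega) (by omega)
  rw [Finset.pair_eq_singleton] at hqB
  obtain ⟨r, hrA, hrB⟩ := exists_pair_mem_pair_mem n K hK1 hK2
    (s := a) (t := c) (u := b) (v := b)
    (by omega) (by omega) (by omega) (by omega) (by omega) (by omega) (by omega) (by omega)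
  rw [Finset.pair_eq_singleton] at hrB
  have hgp : g (charVec n K p) = 0 := by
    simp [hg, charVec_fst, same_iff_of_mem' hpB (u := c), hac]
  have hgq : g (charVec n K q) = 0 := by
    simp [hg, charVec_fst, same_iff_of_mem' hqB (u := c), hac]
  have hgr : g (charVec n K r) = 1 := by
    simp [hg, charVec_fst, same_iff_of_mem' hrA (u := c)]
  have hfp : pawForm a b c d (charVec n K p) = 2 := by
    norm_num [pawForm, charVec_fst, charVec_snd hc.1, charVec_snd hb.1, same_iff_of_mem hpB (u := c),
      same_iff_of_mem' hpB (u := c), isRep_iff_of_mem hpB (v := c),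
      same_iff_of_mem hpA (u := b), same_iff_of_mem' hpA (u := b),
      isRep_iff_of_mem hpA (v := b), hab, hac, hbc, hbc.symm, hcd.symm]
  have hfq : pawForm a b c d (charVec n K q) = 1 := by
    norm_num [pawForm, charVec_fst, charVec_snd hc.1, charVec_snd hb.1, same_iff_of_mem hqB (u := c),
      same_iff_of_mem' hqB (u := c), isRep_iff_of_mem hqB (v := c),
      same_iff_of_mem hqA (u := b), same_iff_of_mem' hqA (u := b),
      isRep_iff_of_mem hqA (v := b), hdb, hab, hac, had, hbc, hbc.symm, hcd, hcd.symm]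
  refine adim_add_one_ne (fun x hx => hx.1) (pawForm a b c d) g
    (α := 2) (β := 0) (fun x hx => hx.2)
    (fun x hx => ?_) (charVec_mem_PolyP p) (charVec_mem_PolyP q) (charVec_mem_PolyP r)
    (by rw [hgp, hgq]) (by rw [hfp, hfq]; norm_num) (by rw [hgr, hgq]; norm_num)
  have h₁ := hg_le x hx.1
  have h₂ := hfg_le x hx.1
  have h₃ : pawForm a b c d x = 2 := hx.2
  rw [LinearMap.add_apply] at h₂
  rw [LinearMap.neg_apply] at h₁
  linarith

/-- For `n ≥ 5`, `3 ≤ K ≤ n-2` and pairwise distinct `a, b, c, d ∈ V` with `b, c ∈ {4,…,n}`,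
`a < b` and `d = min(b,c,d)`: if `c < b` or `K = n-2`, then the face of `P_{n,K}` defined by
the paw inequality `x_{a,b} + x_{b,c} - x_{a,c} + x_{c,d} + x_b + x_c ≤ 2` is not a facet. -/
theorem paw_not_facet (n K a b c d : ℕ) (hn : 5 ≤ n) (hK1 : 3 ≤ K) (hK2 : K ≤ n - 2)
    (ha : a ∈ Finset.Icc 1 n) (hb : b ∈ Finset.Icc 4 n) (hc : c ∈ Finset.Icc 4 n)
    (hd : d ∈ Finset.Icc 1 n)
    (hab : a ≠ b) (hac : a ≠ c) (had : a ≠ d) (hbc : b ≠ c) (hbd : b ≠ d) (hcd : c ≠ d)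
    (hlt : a < b) (hmin : min b (min c d) = d)
    (hcase : c < b ∨ K = n - 2) :
    adim {x | x ∈ PolyP n K ∧
        x.1 (a, b) + x.1 (b, c) - x.1 (a, c) + x.1 (c, d) + x.2 b + x.2 c = 2} + 1 ≠
      adim (PolyP n K) := by
  rw [Finset.mem_Icc] at ha hb hc hd
  have hdb : d < b := lt_of_le_of_ne (hmin ▸ min_le_left _ _) hbd.symm
  have hdc : d < c :=
    lt_of_le_of_ne (hmin ▸ (min_le_right _ _).trans (min_le_left _ _)) hcd.symm
  by_cases hcb : c < b
  · exact pawFace_codim_ne_one_of_lt hK1 hK2 ha hb hc hd hab hac had hbc hcd hlt hdb hdc hcb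
  · exact pawFace_codim_ne_one_of_eq hK1 hK2 ha hb hc hd hab hac had hbc hcd hlt hdb hdc
      (by omega) (hcase.resolve_left hcb)
end
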